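/- Let d ≥ 1, let α = (α_1,…,α_d) with 0 < α_i ≤ 1, let γ be a CRF and L the associated cone-like set. Then for every f ∈ L^1(G^d), the (C,α) means σ_n^{κ,α} f(x) converge to f(x) for almost every x ∈ G^d as min(n_1,…,n_d) → ∞ with n ∈ L. -/

import Mathlib

open MeasureTheory Filter Finset ENNReal

noncomputable section

/-- The Walsh group `G`: countable product of copies of `ℤ/2ℤ`. -/
abbrev WG : Type := ℕ → ZMod 2

/-- The normalized Haar measure (= product of uniform coin-toss measures) on `G`. -/
def μW : Measure WG := Measure.addHaarMeasure ⊤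

instance : (μW).Regular := by unfold μW; infer_instance

instance : IsFiniteMeasure μW := by
  constructor
  rw [← TopologicalSpace.PositiveCompacts.coe_top (α := WG)]
  exact IsCompact.measure_lt_top (⊤ : TopologicalSpace.PositiveCompacts WG).isCompact

/-- The product measure on `G^d`. -/
def μD (d : ℕ) : Measure (Fin d → WG) := Measure.pi fun _ => μW

/-- The `k`-th Rademacher function. -/
def rad (k : ℕ) (x : WG) : ℝ := (-1 : ℝ) ^ (x k).val

/-- The Walsh–Paley function of index `n`. -/
def walsh (n : ℕ) (x : WG) : ℝ :=
  ∏ k ∈ Finset.range n.size, if n.testBit k then rad k x else 1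

/-- The Walsh–Kaczmarz function of index `n`; `Nat.log 2 n` is the order `|n|`. -/
def kacz (n : ℕ) (x : WG) : ℝ :=
  if n = 0 then 1 else
    rad (Nat.log 2 n) x *
      (-1 : ℝ) ^ (∑ k ∈ Finset.range (Nat.log 2 n),
        (if n.testBit k then 1 else 0) * (x (Nat.log 2 n - 1 - k)).val)

/-- The `d`-dimensional Walsh–Kaczmarz function. -/
def kaczD (d : ℕ) (m : Fin d → ℕ) (x : Fin d → WG) : ℝ := ∏ i, kacz (m i) (x i)

/-- Walsh–Paley Dirichlet kernel. -/
def dirW (n : ℕ) (x : WG) : ℝ := ∑ k ∈ Finset.range n, walsh k x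

/-- Walsh–Kaczmarz Dirichlet kernel. -/
def dirK (n : ℕ) (x : WG) : ℝ := ∑ k ∈ Finset.range n, kacz k x

/-- `A_j^α = binom (j+α) j`. -/
def Abin (α : ℝ) (j : ℕ) : ℝ := ∏ i ∈ Finset.range j, (α + i + 1) / (i + 1)

/-- One-dimensional Walsh–Paley `(C,α)` kernel. -/
def KW (α : ℝ) (n : ℕ) (x : WG) : ℝ :=
  (Abin α n)⁻¹ * ∑ k ∈ Finset.range (n + 1), Abin (α - 1) (n - k) * dirW k x

/-- One-dimensional Walsh–Kaczmarz `(C,α)` kernel. -/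
def KK (α : ℝ) (n : ℕ) (x : WG) : ℝ :=
  (Abin α n)⁻¹ * ∑ k ∈ Finset.range (n + 1), Abin (α - 1) (n - k) * dirK k x

/-- The `m`-th Walsh–Kaczmarz–Fourier coefficient of `f : G^d → ℝ`. -/
def fCoeff (d : ℕ) (f : (Fin d → WG) → ℝ) (m : Fin d → ℕ) : ℝ :=
  ∫ x, f x * kaczD d m x ∂ μD d

/-- Rectangular partial sum built from an abstract family `c` of Fourier coefficients. -/
def partialSumOf (d : ℕ) (c : (Fin d → ℕ) → ℝ) (k : Fin d → ℕ) (x : Fin d → WG) : ℝ :=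
  ∑ m ∈ Fintype.piFinset (fun i => Finset.range (k i)), c m * kaczD d m x

/-- `(C,α)` (Cesàro) mean of order `n` built from coefficients `c`. -/
def cesaroOf (d : ℕ) (α : Fin d → ℝ) (c : (Fin d → ℕ) → ℝ) (n : Fin d → ℕ)
    (x : Fin d → WG) : ℝ :=
  (∏ i, Abin (α i) (n i))⁻¹ *
    ∑ k ∈ Fintype.piFinset (fun i => Finset.range (n i + 1)),
      (∏ i, Abin (α i - 1) (n i - k i)) * partialSumOf d c k x

/-- A cone-like restriction function (CRF) family `γ = (γ_j)_{j ≠ 0}`. -/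
structure IsCRF (d : ℕ) [NeZero d] (γ : Fin d → ℝ → ℝ) : Prop where
  strictMono : ∀ j : Fin d, j ≠ 0 → StrictMonoOn (γ j) (Set.Ici 1)
  contOn : ∀ j : Fin d, j ≠ 0 → ContinuousOn (γ j) (Set.Ici 1)
  one_le : ∀ j : Fin d, j ≠ 0 → ∀ x : ℝ, 1 ≤ x → 1 ≤ γ j x
  map_one : ∀ j : Fin d, j ≠ 0 → γ j 1 = 1
  tendsto_atTop : ∀ j : Fin d, j ≠ 0 → Tendsto (γ j) atTop atTop
  reg : ∃ ζ : ℝ, 1 < ζ ∧ ∀ j : Fin d, j ≠ 0 → ∃ c₁ c₂ : ℝ, 1 < c₁ ∧ 1 < c₂ ∧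
    ∀ x : ℝ, 1 ≤ x → c₁ * γ j x ≤ γ j (ζ * x) ∧ γ j (ζ * x) ≤ c₂ * γ j x

/-- The cone-like set `L` determined by `γ` and the parameters `β`. -/
def coneLike (d : ℕ) [NeZero d] (γ : Fin d → ℝ → ℝ) (β : Fin d → ℝ) : Set (Fin d → ℕ) :=
  {n | ∀ j : Fin d, j ≠ 0 → (β j)⁻¹ * γ j (n 0) ≤ (n j : ℝ) ∧ (n j : ℝ) ≤ β j * γ j (n 0)}

/-- `bar γ n₁ = (n₁, n₂, …, n_d)` where `n_j = |γ_j(2^{n₁})|` is the order of `γ_j(2^{n₁})`,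
i.e. `2^{n_j} ≤ γ_j(2^{n₁}) < 2^{n_j+1}`. -/
def bar (d : ℕ) [NeZero d] (γ : Fin d → ℝ → ℝ) (n₁ : ℕ) : Fin d → ℕ :=
  fun j => if j = 0 then n₁ else Nat.log 2 ⌊γ j ((2 : ℝ) ^ n₁)⌋₊

/-- The cone-like restricted maximal operator `σ_L^{κ,α,*}` (built from coefficients `c`). -/
def cesaroMaximal (d : ℕ) [NeZero d] (α : Fin d → ℝ) (γ : Fin d → ℝ → ℝ) (β : Fin d → ℝ)
    (c : (Fin d → ℕ) → ℝ) (x : Fin d → WG) : ℝ≥0∞ :=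
  ⨆ n ∈ coneLike d γ β, ENNReal.ofReal |cesaroOf d α c n x|

/-- `L^p`-"norm" (`0 < p < ∞`) of an `ℝ≥0∞`-valued function on `G^d`. -/
def lpNormE (d : ℕ) (p : ℝ) (g : (Fin d → WG) → ℝ≥0∞) : ℝ≥0∞ :=
  (∫⁻ x, g x ^ p ∂ μD d) ^ (1 / p)

/-- The dyadic rectangle `I_{N}(y) = I_{N_1}(y^1) × ⋯ × I_{N_d}(y^d)`. -/
def rectAt (d : ℕ) (N : Fin d → ℕ) (y : Fin d → WG) : Set (Fin d → WG) :=
  {x | ∀ j : Fin d, ∀ i : ℕ, i < N j → x j i = y j i}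

/-- The one-dimensional dyadic interval `I_N = I_N(0)`. -/
def rectW (N : ℕ) : Set WG := {x | ∀ i : ℕ, i < N → x i = 0}

/-- A one-parameter martingale with respect to the filtration
`(F_{bar γ n₁})_{n₁}` generated by the dyadic rectangles `I_{bar γ n₁}(y)`
(measurability w.r.t. this atomic σ-algebra = being constant on its rectangles,
and the martingale property = equality of integrals over the rectangles). -/
structure ConeMartingale (d : ℕ) [NeZero d] (γ : Fin d → ℝ → ℝ) where
  F : ℕ → (Fin d → WG) → ℝ
  integrable : ∀ n₁, Integrable (F n₁) (μD d)
  adapted : ∀ n₁ (x y : Fin d → WG),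
    (∀ j : Fin d, ∀ i : ℕ, i < bar d γ n₁ j → x j i = y j i) → F n₁ x = F n₁ y
  mart : ∀ n₁ m₁, n₁ ≤ m₁ → ∀ y,
    ∫ x in rectAt d (bar d γ n₁) y, F m₁ x ∂ μD d
      = ∫ x in rectAt d (bar d γ n₁) y, F n₁ x ∂ μD d

/-- The Fourier coefficients of a martingale (the integrals `∫ f_k ψ_m` stabilize). -/
def martCoeff (d : ℕ) [NeZero d] (γ : Fin d → ℝ → ℝ) (f : ConeMartingale d γ) (m : Fin d → ℕ) : ℝ :=
  limUnder atTop (fun k => ∫ x, f.F k x * kaczD d m x ∂ μD d)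

/-- The maximal function `f* = sup_{n₁} |f_{bar n₁}|` of a martingale. -/
def martMaximal (d : ℕ) [NeZero d] (γ : Fin d → ℝ → ℝ) (f : ConeMartingale d γ)
    (x : Fin d → WG) : ℝ≥0∞ :=
  ⨆ n₁ : ℕ, ENNReal.ofReal |f.F n₁ x|

/-- The martingale Hardy space "norm" `‖f‖_{H_p^γ} = ‖f*‖_p`. -/
def hardyNorm (d : ℕ) [NeZero d] (γ : Fin d → ℝ → ℝ) (p : ℝ) (f : ConeMartingale d γ) : ℝ≥0∞ :=
  lpNormE d p (martMaximal d γ f)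

/-- A `p`-atom supported on the rectangle `I_N(y)`. -/
structure IsPAtom (d : ℕ) (p : ℝ) (a : (Fin d → WG) → ℝ) (N : Fin d → ℕ)
    (y : Fin d → WG) : Prop where
  measurable : Measurable a
  support : ∀ x, x ∉ rectAt d N y → a x = 0
  bound : ∀ x, |a x| ≤ ((μD d (rectAt d N y)).toReal) ^ (-(1 / p))
  zero : ∫ x, a x ∂ μD d = 0

/-- The conditional-expectation (dyadic average) of `f` at level `N`. -/
def avgAt (d : ℕ) (N : Fin d → ℕ) (f : (Fin d → WG) → ℝ) (x : Fin d → WG) : ℝ :=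
  (2 : ℝ) ^ (∑ j, N j) * ∫ t in rectAt d N x, f t ∂ μD d

/-- `m` is the martingale generated by the integrable function `f`. -/
def inducedLevels (d : ℕ) [NeZero d] (γ : Fin d → ℝ → ℝ) (f : (Fin d → WG) → ℝ)
    (m : ConeMartingale d γ) : Prop :=
  ∀ n₁ x, m.F n₁ x = avgAt d (bar d γ n₁) f x

/-- The martingale maximal function of (the martingale generated by) a function `f`,
`f* = sup_{n₁} |S_{2^{bar γ n₁}} f|`. -/
def funMaximal (d : ℕ) [NeZero d] (γ : Fin d → ℝ → ℝ) (f : (Fin d → WG) → ℝ)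
    (x : Fin d → WG) : ℝ≥0∞ :=
  ⨆ n₁ : ℕ, ENNReal.ofReal |partialSumOf d (fCoeff d f) (fun j => 2 ^ bar d γ n₁ j) x|

/-- The Hardy norm `‖f‖_{H_p^γ}` of (the martingale generated by) a function `f`. -/
def funHardyNorm (d : ℕ) [NeZero d] (γ : Fin d → ℝ → ℝ) (p : ℝ) (f : (Fin d → WG) → ℝ) : ℝ≥0∞ :=
  lpNormE d p (funMaximal d γ f)

/-- Skvortsov's bit-reversal transformation `τ_A`. -/
def tau (A : ℕ) (x : WG) : WG := fun i => if i < A then x (A - 1 - i) else x i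

end

noncomputable section

section WalshPaley

/-- The coordinate shift by `p` on the Walsh group. -/
def wshift (p : ℕ) (y : WG) : WG := fun i => y (i + p)

lemma rad_of_zero {k : ℕ} {x : WG} (h : x k = 0) : rad k x = 1 := by
  simp [rad, h]

lemma rad_of_one {k : ℕ} {x : WG} (h : x k = 1) : rad k x = -1 := by
  have : (1 : ZMod 2).val = 1 := rfl
  simp [rad, h, this]

lemma zmod_two_cases (a : ZMod 2) : a = 0 ∨ a = 1 := by
  revert a; decide

lemma rad_add (k : ℕ) (x y : WG) : rad k (x + y) = rad k x * rad k y := by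
  rcases zmod_two_cases (x k) with hx | hx <;> rcases zmod_two_cases (y k) with hy | hy
  · rw [rad_of_zero hx, rad_of_zero hy, rad_of_zero (by simp [hx, hy])]; norm_num
  · rw [rad_of_zero hx, rad_of_one hy, rad_of_one (by simp [hx, hy])]; norm_num
  · rw [rad_of_one hx, rad_of_zero hy, rad_of_one (by simp [hx, hy])]; norm_num
  · rw [rad_of_one hx, rad_of_one hy, rad_of_zero]
    · norm_num
    · rw [Pi.add_apply, hx, hy]; decide

lemma walsh_eq_prod_range {n p : ℕ} (h : n < 2 ^ p) (x : WG) :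
    walsh n x = ∏ k ∈ Finset.range p, if n.testBit k then rad k x else 1 := by
  unfold walsh
  apply Finset.prod_subset
  · intro k hk
    exact Finset.mem_range.2 (lt_of_lt_of_le (Finset.mem_range.1 hk) (Nat.size_le.2 h))
  · intro k _ hk
    have hlt : n < 2 ^ k := Nat.size_le.1 (not_lt.1 fun h => hk (Finset.mem_range.2 h))
    rw [Nat.testBit_lt_two_pow hlt]; simp

lemma abs_rad (k : ℕ) (x : WG) : |rad k x| = 1 := by
  rcases zmod_two_cases (x k) with hx | hx
  · rw [rad_of_zero hx]; norm_num
  · rw [rad_of_one hx]; norm_num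

lemma abs_walsh (n : ℕ) (x : WG) : |walsh n x| = 1 := by
  unfold walsh
  rw [Finset.abs_prod]
  apply Finset.prod_eq_one
  intro k _
  split_ifs
  · exact abs_rad k x
  · norm_num

lemma walsh_two_pow_mul_add {p r : ℕ} (q : ℕ) (hr : r < 2 ^ p) (y : WG) :
    walsh (2 ^ p * q + r) y = walsh q (wshift p y) * walsh r y := by
  have hq : q < 2 ^ q.size := Nat.size_le.1 le_rfl
  have hlt : 2 ^ p * q + r < 2 ^ (p + q.size) := by
    rw [pow_add]
    calc 2 ^ p * q + r < 2 ^ p * q + 2 ^ p := by omega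
      _ = 2 ^ p * (q + 1) := by ring
      _ ≤ 2 ^ p * 2 ^ q.size := Nat.mul_le_mul_left _ hq
  rw [walsh_eq_prod_range hlt, walsh_eq_prod_range hq, walsh_eq_prod_range hr,
    Finset.prod_range_add, mul_comm]
  congr 1
  · refine Finset.prod_congr rfl fun k _ => ?_
    rw [Nat.testBit_two_pow_mul_add q hr]
    simp [wshift, rad, add_comm p k]
  · refine Finset.prod_congr rfl fun k hk => ?_
    rw [Nat.testBit_two_pow_mul_add q hr, if_pos (Finset.mem_range.1 hk)]

lemma walsh_zero (y : WG) : walsh 0 y = 1 := by simp [walsh]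

lemma walsh_one (y : WG) : walsh 1 y = rad 0 y := by
  rw [walsh_eq_prod_range (p := 1) (by norm_num)]; simp

lemma walsh_of_zeros {s n : ℕ} (hn : n < 2 ^ s) {y : WG} (hy : ∀ i < s, y i = 0) :
    walsh n y = 1 := by
  rw [walsh_eq_prod_range hn]
  refine Finset.prod_eq_one fun k hk => ?_
  rw [rad_of_zero (hy k (Finset.mem_range.1 hk))]; simp

lemma sum_range_mul_eq (F : ℕ → ℝ) (B Q : ℕ) :
    ∑ l ∈ Finset.range (B * Q), F l =
      ∑ q ∈ Finset.range Q, ∑ r ∈ Finset.range B, F (B * q + r) := by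
  induction Q with
  | zero => simp
  | succ Q ih => rw [Nat.mul_succ, Finset.sum_range_add, ih, Finset.sum_range_succ]

lemma dirW_two_pow_mul_add {p r : ℕ} (q : ℕ) (hr : r ≤ 2 ^ p) (y : WG) :
    dirW (2 ^ p * q + r) y =
      dirW q (wshift p y) * dirW (2 ^ p) y + walsh q (wshift p y) * dirW r y := by
  unfold dirW
  rw [Finset.sum_range_add, sum_range_mul_eq, Finset.sum_mul, Finset.mul_sum]
  congr 1
  · refine Finset.sum_congr rfl fun a _ => ?_
    rw [Finset.mul_sum]
    exact Finset.sum_congr rfl fun b hb => walsh_two_pow_mul_add a (Finset.mem_range.1 hb) y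
  · exact Finset.sum_congr rfl fun b hb =>
      walsh_two_pow_mul_add q (lt_of_lt_of_le (Finset.mem_range.1 hb) hr) y

lemma dirW_one (y : WG) : dirW 1 y = 1 := by simp [dirW, walsh_zero]

lemma dirW_of_zeros {s n : ℕ} (hn : n ≤ 2 ^ s) {y : WG} (hy : ∀ i < s, y i = 0) :
    dirW n y = n := by
  unfold dirW
  rw [Finset.sum_congr rfl fun k hk =>
    walsh_of_zeros (lt_of_lt_of_le (Finset.mem_range.1 hk) hn) hy]
  simp

lemma dirW_two_pow_succ (p : ℕ) (y : WG) :
    dirW (2 ^ (p + 1)) y = (1 + rad p y) * dirW (2 ^ p) y := by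
  have h := dirW_two_pow_mul_add (p := p) 1 le_rfl y
  rw [dirW_one, walsh_one] at h
  have e : 2 ^ p * 1 + 2 ^ p = 2 ^ (p + 1) := by ring
  rw [e] at h
  rw [h]
  simp only [rad, wshift, zero_add]
  ring

lemma dirW_two_pow (p : ℕ) (y : WG) :
    dirW (2 ^ p) y = if ∀ i < p, y i = 0 then 2 ^ p else 0 := by
  induction p with
  | zero => simp [dirW_one]
  | succ p ih =>
    rw [dirW_two_pow_succ, ih]
    rcases zmod_two_cases (y p) with h | h
    · rw [rad_of_zero h]
      have : (∀ i < p + 1, y i = 0) ↔ ∀ i < p, y i = 0 := by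
        constructor
        · intro H i hi; exact H i (by omega)
        · intro H i hi
          rcases Nat.lt_succ_iff_lt_or_eq.1 hi with hi | rfl
          · exact H i hi
          · exact h
      simp only [this]
      split_ifs <;> ring
    · rw [rad_of_one h, if_neg (c := ∀ i < p + 1, y i = 0)]
      · ring
      · intro H
        have := H p (by omega)
        rw [h] at this
        exact absurd this (by decide)

lemma abs_dirW_le (n : ℕ) (y : WG) : |dirW n y| ≤ n := by
  unfold dirW
  refine (Finset.abs_sum_le_sum_abs _ _).trans ?_
  simp [abs_walsh]

lemma dirW_bounds_of_first_one {s r : ℕ} {y : WG} (hy : ∀ i < s, y i = 0) (hs : y s = 1)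
    (hr : r ≤ 2 ^ (s + 1)) : 0 ≤ dirW r y ∧ dirW r y ≤ 2 ^ s := by
  rcases le_total r (2 ^ s) with h | h
  · rw [dirW_of_zeros h hy]
    exact ⟨by positivity, by exact_mod_cast h⟩
  · obtain ⟨r', rfl⟩ := Nat.exists_eq_add_of_le h
    have hr' : r' ≤ 2 ^ s := by rw [pow_succ] at hr; omega
    have e := dirW_two_pow_mul_add 1 hr' y
    rw [mul_one] at e
    have h0 : (wshift s y) 0 = 1 := by simp [wshift, hs]
    rw [e, dirW_one, walsh_one, rad_of_one h0, dirW_of_zeros le_rfl hy, dirW_of_zeros hr' hy]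
    have : (r' : ℝ) ≤ 2 ^ s := by exact_mod_cast hr'
    push_cast
    constructor
    · linarith
    · have : (0 : ℝ) ≤ r' := by positivity
      linarith

/-- A majorant of the Walsh–Paley Dirichlet kernels of index at most `2 ^ J`. -/
def dirMaj (J : ℕ) (z : WG) : ℝ :=
  ∑ j ∈ Finset.range (J + 1), 2 ^ j * (if ∀ i < j, z i = 0 then 1 else 0)

lemma one_le_dirMaj (J : ℕ) (z : WG) : 1 ≤ dirMaj J z := by
  unfold dirMaj
  rw [Finset.sum_range_succ']
  simp only [pow_zero, _root_.not_lt_zero, IsEmpty.forall_iff, implies_true, if_true, mul_one]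
  have : 0 ≤ ∑ k ∈ Finset.range J,
      (2 : ℝ) ^ (k + 1) * (if ∀ i < k + 1, z i = 0 then 1 else 0) :=
    Finset.sum_nonneg fun k _ => by split_ifs <;> positivity
  linarith

lemma dirMaj_succ (J : ℕ) (z : WG) :
    dirMaj (J + 1) z = (1 + rad 0 z) * dirMaj J (wshift 1 z) + 1 := by
  unfold dirMaj
  rw [Finset.sum_range_succ', Finset.mul_sum]
  congr 1
  · refine Finset.sum_congr rfl fun j _ => ?_
    rcases zmod_two_cases (z 0) with h | h
    · rw [rad_of_zero h]
      have : (∀ i < j + 1, z i = 0) ↔ ∀ i < j, (wshift 1 z) i = 0 := by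
        constructor
        · intro H i hi; exact H (i + 1) (by omega)
        · intro H i hi
          cases i with
          | zero => exact h
          | succ i => exact H i (by omega)
      simp only [this]
      ring
    · rw [rad_of_one h, if_neg (c := ∀ i < j + 1, z i = 0)]
      · ring
      · intro H
        have := H 0 (by omega)
        rw [h] at this
        exact absurd this (by decide)
  · simp

lemma abs_dirW_le_dirMaj (J : ℕ) : ∀ (Q : ℕ) (z : WG), Q ≤ 2 ^ J → |dirW Q z| ≤ dirMaj J z := by
  induction J with
  | zero =>
    intro Q z hQ
    refine (abs_dirW_le Q z).trans ((?_ : (Q : ℝ) ≤ 1).trans (one_le_dirMaj 0 z))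
    exact_mod_cast hQ
  | succ J ih =>
    intro Q z hQ
    have hb : Q % 2 ≤ 1 := by omega
    have e := dirW_two_pow_mul_add (p := 1) (r := Q % 2) (Q / 2) (by omega) z
    have h2 : dirW 2 z = 1 + rad 0 z := by simpa [dirW_one] using dirW_two_pow_succ 0 z
    rw [pow_one, Nat.div_add_mod, h2] at e
    rw [e, dirMaj_succ]
    have h0 : 0 ≤ 1 + rad 0 z := by
      have := abs_le.1 (abs_rad 0 z).le; linarith
    refine (abs_add_le _ _).trans (add_le_add ?_ ?_)
    · rw [abs_mul, abs_of_nonneg h0, mul_comm]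
      exact mul_le_mul_of_nonneg_left (ih _ _ (by rw [pow_succ] at hQ; omega)) h0
    · rw [abs_mul, abs_walsh, one_mul]
      exact (abs_dirW_le _ z).trans (by exact_mod_cast hb)

lemma abel_monotone_bound {c w : ℕ → ℝ} {G : ℝ} (hc : Monotone c)
    {Q : ℕ} (hG : ∀ i ≤ Q + 1, |∑ q ∈ Finset.range i, w q| ≤ G) :
    |∑ q ∈ Finset.range (Q + 1), c q * w q - c Q * ∑ q ∈ Finset.range (Q + 1), w q|
      ≤ G * (c Q - c 0) := by
  induction Q with
  | zero => simp
  | succ Q ih =>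
    have ih' := ih fun i hi => hG i (by omega)
    have h1 := hG (Q + 1) (by omega)
    have h2 : 0 ≤ c (Q + 1) - c Q := sub_nonneg.2 (hc (by omega))
    have e : ∑ q ∈ Finset.range (Q + 1 + 1), c q * w q
          - c (Q + 1) * ∑ q ∈ Finset.range (Q + 1 + 1), w q =
        (∑ q ∈ Finset.range (Q + 1), c q * w q - c Q * ∑ q ∈ Finset.range (Q + 1), w q)
          - (c (Q + 1) - c Q) * ∑ q ∈ Finset.range (Q + 1), w q := by
      rw [Finset.sum_range_succ _ (Q + 1), Finset.sum_range_succ w (Q + 1)]; ring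
    rw [e]
    refine (abs_sub _ _).trans ?_
    rw [abs_mul, abs_of_nonneg h2]
    have := mul_le_mul_of_nonneg_left h1 h2
    linarith

lemma abs_weighted_sum_le {c w : ℕ → ℝ} {G W : ℝ} (hc : Monotone c) (h0 : 0 ≤ c 0)
    {Q : ℕ} (hG : ∀ i ≤ Q, |∑ q ∈ Finset.range i, w q| ≤ G) (hW : ∀ q < Q, c q ≤ W)
    (hW0 : 0 ≤ W) :
    |∑ q ∈ Finset.range Q, c q * w q| ≤ 2 * G * W := by
  have hG0 : 0 ≤ G := (abs_nonneg _).trans (hG 0 (by omega))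
  cases Q with
  | zero => simp; positivity
  | succ Q =>
    have h1 := abel_monotone_bound hc hG
    have h2 := hG (Q + 1) le_rfl
    have h3 := hW Q (by omega)
    have h4 : 0 ≤ c Q := h0.trans (hc (by omega))
    have h5 : |c Q * ∑ q ∈ Finset.range (Q + 1), w q| ≤ c Q * G := by
      rw [abs_mul, abs_of_nonneg h4]; exact mul_le_mul_of_nonneg_left h2 h4
    have h6 := abs_sub_abs_le_abs_sub (∑ q ∈ Finset.range (Q + 1), c q * w q)
      (c Q * ∑ q ∈ Finset.range (Q + 1), w q)
    nlinarith [mul_le_mul_of_nonneg_left h3 hG0, mul_nonneg hG0 h0]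

/-- The basic estimate for monotone weighted sums of Walsh–Paley Dirichlet kernels. -/
lemma abs_sum_mul_dirW_le {s J m : ℕ} {y : WG} (hy : ∀ i < s, y i = 0) (hs : y s = 1)
    {a : ℕ → ℝ} (ha : Monotone a) (ha0 : 0 ≤ a 0) (hm : m ≤ 2 ^ (s + 1 + J)) {W : ℝ}
    (hW : ∀ p q, p ≤ q → q ≤ m → q ≤ p + 2 ^ (s + 1) → ∑ l ∈ Finset.Ico p q, a l ≤ W) :
    |∑ l ∈ Finset.range m, a l * dirW l y| ≤ 3 * 2 ^ s * W * dirMaj J (wshift (s + 1) y) := by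
  set B := 2 ^ (s + 1) with hB
  set z := wshift (s + 1) y with hz
  have hBpos : 0 < B := by positivity
  have han : ∀ l, 0 ≤ a l := fun l => ha0.trans (ha (by omega))
  have hW0 : 0 ≤ W := by simpa using hW 0 0 le_rfl (by omega) (by omega)
  have hφ : ∀ r ≤ B, 0 ≤ dirW r y ∧ dirW r y ≤ 2 ^ s := fun r hr =>
    dirW_bounds_of_first_one hy hs hr
  have hDB : dirW B y = 0 := by
    rw [hB, dirW_two_pow, if_neg]
    intro H
    have := H s (by omega)
    rw [hs] at this
    exact absurd this (by decide)
  have hD : ∀ q r, r ≤ B → dirW (B * q + r) y = walsh q z * dirW r y := by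
    intro q r hr
    rw [hB, dirW_two_pow_mul_add q hr, ← hB, hDB]; simp [hz]
  have hwin : ∀ p r, r ≤ B → p + r ≤ m → ∑ i ∈ Finset.range r, a (p + i) ≤ W := by
    intro p r hr hpr
    have := hW p (p + r) (by omega) hpr (by omega)
    rwa [Finset.sum_Ico_eq_sum_range, Nat.add_sub_cancel_left] at this
  have hwinφ : ∀ p r, r ≤ B → p + r ≤ m →
      ∑ i ∈ Finset.range r, a (p + i) * dirW i y ≤ 2 ^ s * W := by
    intro p r hr hpr
    calc ∑ i ∈ Finset.range r, a (p + i) * dirW i y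
        ≤ ∑ i ∈ Finset.range r, a (p + i) * 2 ^ s := by
          refine Finset.sum_le_sum fun i hi => mul_le_mul_of_nonneg_left (hφ i ?_).2 (han _)
          have := Finset.mem_range.1 hi; omega
      _ = 2 ^ s * ∑ i ∈ Finset.range r, a (p + i) := by rw [← Finset.sum_mul, mul_comm]
      _ ≤ 2 ^ s * W := mul_le_mul_of_nonneg_left (hwin p r hr hpr) (by positivity)
  have hnnφ : ∀ p r, r ≤ B → 0 ≤ ∑ i ∈ Finset.range r, a (p + i) * dirW i y := by
    intro p r hr
    refine Finset.sum_nonneg fun i hi => mul_nonneg (han _) (hφ i ?_).1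
    have := Finset.mem_range.1 hi; omega
  set Q := m / B with hQ
  set R := m % B with hR
  have hmQR : B * Q + R = m := Nat.div_add_mod m B
  have hRB : R < B := Nat.mod_lt _ hBpos
  have hQJ : Q ≤ 2 ^ J := by
    rw [hQ]; apply Nat.div_le_of_le_mul; rw [hB, ← pow_add]; exact hm
  set c : ℕ → ℝ := fun q => ∑ r ∈ Finset.range B, a (B * q + r) * dirW r y with hc
  have hcm : Monotone c := by
    intro q q' hqq
    refine Finset.sum_le_sum fun r hr => mul_le_mul_of_nonneg_right (ha ?_)
      (hφ r (Finset.mem_range.1 hr).le).1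
    have := Nat.mul_le_mul_left B hqq
    omega
  have hsplit : ∑ l ∈ Finset.range m, a l * dirW l y =
      ∑ q ∈ Finset.range Q, c q * walsh q z +
        walsh Q z * ∑ r ∈ Finset.range R, a (B * Q + r) * dirW r y := by
    rw [← hmQR, Finset.sum_range_add, sum_range_mul_eq]
    congr 1
    · refine Finset.sum_congr rfl fun q _ => ?_
      rw [hc, Finset.sum_mul]
      refine Finset.sum_congr rfl fun r hr => ?_
      rw [hD q r (Finset.mem_range.1 hr).le]; ring
    · rw [Finset.mul_sum]
      refine Finset.sum_congr rfl fun r hr => ?_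
      rw [hD Q r (by have := Finset.mem_range.1 hr; omega)]; ring
  rw [hsplit]
  have h1 : |∑ q ∈ Finset.range Q, c q * walsh q z| ≤ 2 * dirMaj J z * (2 ^ s * W) := by
    refine abs_weighted_sum_le hcm (hnnφ _ _ le_rfl)
      (fun i hi => abs_dirW_le_dirMaj J i z (hi.trans hQJ)) (fun q hq => ?_) (by positivity)
    refine hwinφ (B * q) B le_rfl ?_
    have := Nat.mul_le_mul_left B (Nat.succ_le_of_lt hq)
    rw [Nat.mul_succ] at this
    omega
  have h2 : |walsh Q z * ∑ r ∈ Finset.range R, a (B * Q + r) * dirW r y| ≤ 2 ^ s * W := by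
    rw [abs_mul, abs_walsh, one_mul, abs_of_nonneg (hnnφ _ _ hRB.le)]
    exact hwinφ _ _ hRB.le hmQR.le
  refine (abs_add_le _ _).trans ?_
  have h3 : 2 ^ s * W * 1 ≤ 2 ^ s * W * dirMaj J z :=
    mul_le_mul_of_nonneg_left (one_le_dirMaj J z) (by positivity)
  linarith

end WalshPaley

section KaczmarzKernel

lemma log_two_pow_add {A l : ℕ} (h : l < 2 ^ A) : Nat.log 2 (2 ^ A + l) = A := by
  rw [Nat.log_eq_iff (Or.inr ⟨by norm_num, by positivity⟩), pow_succ]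
  omega

lemma kacz_two_pow_add {A l : ℕ} (h : l < 2 ^ A) (x : WG) :
    kacz (2 ^ A + l) x = rad A x * walsh l (tau A x) := by
  have h0 : 2 ^ A + l ≠ 0 := by positivity
  rw [kacz, if_neg h0, log_two_pow_add h, walsh_eq_prod_range h, ← Finset.prod_pow_eq_pow_sum]
  congr 1
  refine Finset.prod_congr rfl fun k hk => ?_
  have hk' := Finset.mem_range.1 hk
  rw [Nat.testBit_two_pow_add_gt hk']
  by_cases hb : l.testBit k = true
  · simp [hb, rad, tau, hk']
  · simp [hb]

lemma walsh_add (n : ℕ) (x y : WG) : walsh n (x + y) = walsh n x * walsh n y := by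
  unfold walsh
  rw [← Finset.prod_mul_distrib]
  refine Finset.prod_congr rfl fun k _ => ?_
  split_ifs
  · exact rad_add k x y
  · norm_num

lemma tau_add (A : ℕ) (x y : WG) : tau A (x + y) = tau A x + tau A y := by
  funext i
  simp only [tau, Pi.add_apply]
  split_ifs <;> rfl

lemma kacz_zero (x : WG) : kacz 0 x = 1 := by simp [kacz]

lemma exists_two_pow_add {n : ℕ} (hn : n ≠ 0) : ∃ A l, l < 2 ^ A ∧ n = 2 ^ A + l := by
  refine ⟨Nat.log 2 n, n - 2 ^ Nat.log 2 n, ?_, ?_⟩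
  · have := Nat.lt_pow_succ_log_self (b := 2) (by norm_num) n
    rw [pow_succ] at this
    have := Nat.pow_log_le_self 2 hn
    omega
  · have := Nat.pow_log_le_self 2 hn
    omega

lemma kacz_add (n : ℕ) (x y : WG) : kacz n (x + y) = kacz n x * kacz n y := by
  rcases eq_or_ne n 0 with rfl | hn
  · simp [kacz_zero]
  · obtain ⟨A, l, hl, rfl⟩ := exists_two_pow_add hn
    rw [kacz_two_pow_add hl, kacz_two_pow_add hl, kacz_two_pow_add hl, rad_add, tau_add, walsh_add]
    ring

lemma abs_kacz (n : ℕ) (x : WG) : |kacz n x| = 1 := by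
  rcases eq_or_ne n 0 with rfl | hn
  · simp [kacz_zero]
  · obtain ⟨A, l, hl, rfl⟩ := exists_two_pow_add hn
    rw [kacz_two_pow_add hl, abs_mul, abs_rad, abs_walsh, one_mul]

lemma dirK_two_pow_add {A m : ℕ} (h : m ≤ 2 ^ A) (x : WG) :
    dirK (2 ^ A + m) x = dirK (2 ^ A) x + rad A x * dirW m (tau A x) := by
  unfold dirK dirW
  rw [Finset.sum_range_add, Finset.mul_sum]
  congr 1
  exact Finset.sum_congr rfl fun l hl =>
    kacz_two_pow_add (lt_of_lt_of_le (Finset.mem_range.1 hl) h) x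

lemma forall_lt_succ_zero_iff (p : ℕ) (y : WG) :
    (∀ i < p + 1, y i = 0) ↔ (∀ i < p, y i = 0) ∧ y p = 0 := by
  constructor
  · intro H; exact ⟨fun i hi => H i (by omega), H p (by omega)⟩
  · rintro ⟨H, h⟩ i hi
    rcases Nat.lt_succ_iff_lt_or_eq.1 hi with hi | rfl
    · exact H i hi
    · exact h

lemma tau_zeros_iff (A : ℕ) (x : WG) : (∀ i < A, tau A x i = 0) ↔ ∀ i < A, x i = 0 := by
  constructor
  · intro H i hi
    have := H (A - 1 - i) (by omega)
    rw [tau, if_pos (by omega)] at this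
    rwa [show A - 1 - (A - 1 - i) = i by omega] at this
  · intro H i hi
    rw [tau, if_pos hi]; exact H _ (by omega)

lemma dirK_two_pow (A : ℕ) (x : WG) :
    dirK (2 ^ A) x = if ∀ i < A, x i = 0 then 2 ^ A else 0 := by
  induction A with
  | zero => simp [dirK, kacz_zero]
  | succ A ih =>
    rw [show 2 ^ (A + 1) = 2 ^ A + 2 ^ A by ring, dirK_two_pow_add le_rfl, ih, dirW_two_pow]
    simp only [tau_zeros_iff, forall_lt_succ_zero_iff]
    by_cases H : ∀ i < A, x i = 0
    · rcases zmod_two_cases (x A) with h | h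
      · rw [rad_of_zero h, if_pos H, if_pos ⟨H, h⟩]; ring
      · rw [rad_of_one h, if_pos H, if_neg (by rw [h]; simp)]; ring
    · simp [H]

lemma Abin_zero (α : ℝ) : Abin α 0 = 1 := by simp [Abin]

lemma Abin_succ (α : ℝ) (n : ℕ) : Abin α (n + 1) = Abin α n * ((α + n + 1) / (n + 1)) := by
  rw [Abin, Abin, Finset.prod_range_succ]

lemma Abin_nonneg {α : ℝ} (hα : -1 ≤ α) (n : ℕ) : 0 ≤ Abin α n :=
  Finset.prod_nonneg fun i _ => by
    have : (0 : ℝ) ≤ i := by positivity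
    exact div_nonneg (by linarith) (by positivity)

lemma Abin_antitone {α : ℝ} (h1 : -1 ≤ α) (h2 : α ≤ 0) : Antitone (Abin α) := by
  refine antitone_nat_of_succ_le fun n => ?_
  rw [Abin_succ]
  refine mul_le_of_le_one_right (Abin_nonneg h1 n) ?_
  rw [div_le_one (by positivity)]
  linarith

lemma Abin_le_one {α : ℝ} (h1 : -1 ≤ α) (h2 : α ≤ 0) (n : ℕ) : Abin α n ≤ 1 := by
  simpa [Abin_zero] using Abin_antitone h1 h2 (Nat.zero_le n)

lemma sum_Abin (α : ℝ) (n : ℕ) : ∑ j ∈ Finset.range (n + 1), Abin (α - 1) j = Abin α n := by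
  induction n with
  | zero => simp [Abin_zero]
  | succ n ih =>
    have key : ∀ m : ℕ, Abin (α - 1) (m + 1) * (m + 1) = Abin α m * α := by
      intro m
      induction m with
      | zero => simp [Abin_succ, Abin_zero]
      | succ m ihm =>
        rw [Abin_succ (α - 1) (m + 1), Abin_succ α m]
        have h1 : (m : ℝ) + 1 ≠ 0 := by positivity
        have h2 : (m : ℝ) + 1 + 1 ≠ 0 := by positivity
        have e : Abin (α - 1) (m + 1) = Abin α m * α / (m + 1) := by
          rw [eq_div_iff h1, ihm]
        rw [e]
        push_cast
        field_simp
        ring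
    rw [Finset.sum_range_succ, ih, Abin_succ α]
    have h1 : (n : ℝ) + 1 ≠ 0 := by positivity
    have e : Abin (α - 1) (n + 1) = Abin α n * α / (n + 1) := by
      rw [eq_div_iff h1, key]
    rw [e]
    field_simp
    ring

lemma rpow_le_Abin {α : ℝ} (h0 : 0 < α) (h1 : α ≤ 1) (n : ℕ) : ((n : ℝ) + 1) ^ α ≤ Abin α n := by
  induction n with
  | zero => simp [Abin_zero]
  | succ n ih =>
    rw [Abin_succ]
    have hn : (0 : ℝ) < (n : ℝ) + 1 := by positivity
    have hn' : 0 ≤ 1 / ((n : ℝ) + 1) := by positivity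
    have hb : (1 + 1 / ((n : ℝ) + 1)) ^ α ≤ 1 + α * (1 / ((n : ℝ) + 1)) :=
      rpow_one_add_le_one_add_mul_self (by linarith) h0.le h1
    have e : ((n + 1 : ℕ) : ℝ) + 1 = ((n : ℝ) + 1) * (1 + 1 / ((n : ℝ) + 1)) := by
      push_cast; field_simp
    rw [e, Real.mul_rpow hn.le (by positivity)]
    refine mul_le_mul ih (hb.trans_eq ?_) (by positivity) (Abin_nonneg (by linarith) n)
    field_simp
    ring

lemma Abin_le_rpow {α : ℝ} (h0 : 0 < α) (h1 : α ≤ 1) (n : ℕ) :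
    Abin α n ≤ 2 * ((n : ℝ) + 1) ^ α := by
  have key : ∀ m : ℕ, Abin α (m + 1) ≤ (1 + α) * ((m : ℝ) + 1) ^ α := by
    intro m
    induction m with
    | zero => simp [Abin_succ, Abin_zero, add_comm]
    | succ m ih =>
      rw [Abin_succ]
      have hm : (0 : ℝ) < (m : ℝ) + 1 := by positivity
      have hm2 : (0 : ℝ) < (m : ℝ) + 2 := by positivity
      have hm0 : (0 : ℝ) ≤ m := by positivity
      have hb : (1 + -(1 / ((m : ℝ) + 2))) ^ α ≤ 1 + α * -(1 / ((m : ℝ) + 2)) := by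
        refine rpow_one_add_le_one_add_mul_self ?_ h0.le h1
        have : 1 / ((m : ℝ) + 2) ≤ 1 := by rw [div_le_one hm2]; linarith
        linarith
      have e1 : 1 + -(1 / ((m : ℝ) + 2)) = ((m : ℝ) + 1) / (m + 2) := by
        field_simp; ring
      rw [e1, Real.div_rpow hm.le hm2.le, div_le_iff₀ (by positivity)] at hb
      have hpos : 0 < ((m : ℝ) + 2) ^ α := by positivity
      have hpos1 : 0 < ((m : ℝ) + 1) ^ α := by positivity
      have hcast : ((m + 1 : ℕ) : ℝ) + 1 = (m : ℝ) + 2 := by push_cast; ring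
      have hcast' : α + ((m + 1 : ℕ) : ℝ) + 1 = (m : ℝ) + 2 + α := by push_cast; ring
      rw [hcast, hcast']
      have hstep : ((m : ℝ) + 1) ^ α * ((m + 2 + α) / (m + 2)) ≤ ((m : ℝ) + 2) ^ α := by
        have e2 : (1 + α * -(1 / ((m : ℝ) + 2))) * ((m + 2 + α) / (m + 2)) ≤ 1 := by
          have : (1 + α * -(1 / ((m : ℝ) + 2))) * ((m + 2 + α) / (m + 2)) =
              1 - (α / (m + 2)) ^ 2 := by field_simp; ring
          rw [this]; nlinarith [sq_nonneg (α / ((m : ℝ) + 2))]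
        calc ((m : ℝ) + 1) ^ α * ((m + 2 + α) / (m + 2))
            ≤ ((1 + α * -(1 / ((m : ℝ) + 2))) * ((m : ℝ) + 2) ^ α) * ((m + 2 + α) / (m + 2)) :=
              mul_le_mul_of_nonneg_right hb (by positivity)
          _ = ((1 + α * -(1 / ((m : ℝ) + 2))) * ((m + 2 + α) / (m + 2))) * ((m : ℝ) + 2) ^ α := by
              ring
          _ ≤ 1 * ((m : ℝ) + 2) ^ α := mul_le_mul_of_nonneg_right e2 hpos.le
          _ = _ := one_mul _
      calc Abin α (m + 1) * ((m + 2 + α) / (m + 2))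
          ≤ (1 + α) * ((m : ℝ) + 1) ^ α * ((m + 2 + α) / (m + 2)) :=
            mul_le_mul_of_nonneg_right ih (by positivity)
        _ = (1 + α) * (((m : ℝ) + 1) ^ α * ((m + 2 + α) / (m + 2))) := by ring
        _ ≤ _ := mul_le_mul_of_nonneg_left hstep (by linarith)
  cases n with
  | zero => simp [Abin_zero]
  | succ m =>
    refine (key m).trans (mul_le_mul (by linarith) ?_ (by positivity) (by norm_num))
    refine Real.rpow_le_rpow (by positivity) ?_ h0.le
    push_cast; linarith

lemma sum_window_Abin_le {α : ℝ} (h0 : 0 < α) (h1 : α ≤ 1) {R p q B : ℕ} (hB : 0 < B)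
    (hpq : p ≤ q) (hqR : q ≤ R + 1) (hq : q ≤ p + B) :
    ∑ l ∈ Finset.Ico p q, Abin (α - 1) (R - l) ≤ 2 * (B : ℝ) ^ α := by
  have hm1 : -1 ≤ α - 1 := by linarith
  calc ∑ l ∈ Finset.Ico p q, Abin (α - 1) (R - l)
      = ∑ i ∈ Finset.range (q - p), Abin (α - 1) (R - (p + i)) :=
        Finset.sum_Ico_eq_sum_range _ _ _
    _ ≤ ∑ i ∈ Finset.range (q - p), Abin (α - 1) (q - p - 1 - i) := by
        refine Finset.sum_le_sum fun i hi => Abin_antitone hm1 (by linarith) ?_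
        have := Finset.mem_range.1 hi; omega
    _ = ∑ i ∈ Finset.range (q - p), Abin (α - 1) i :=
        Finset.sum_range_reflect (fun j => Abin (α - 1) j) (q - p)
    _ ≤ ∑ i ∈ Finset.range (B - 1 + 1), Abin (α - 1) i := by
        refine Finset.sum_le_sum_of_subset_of_nonneg ?_ fun i _ _ => Abin_nonneg hm1 i
        intro i hi; rw [Finset.mem_range] at *; omega
    _ ≤ 2 * (((B - 1 : ℕ) : ℝ) + 1) ^ α := by
        rw [sum_Abin]; exact Abin_le_rpow h0 h1 _
    _ = _ := by
        rw [Nat.cast_sub hB]; simp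

/-- The element of the Walsh group whose coordinates are the binary digits of `k`. -/
def digitPt (k : ℕ) : WG := fun i => if k.testBit i then 1 else 0

lemma exists_digits (A : ℕ) (x : WG) : ∃ k < 2 ^ A, ∀ i < A, x i = digitPt k i := by
  induction A with
  | zero => exact ⟨0, by simp, by simp⟩
  | succ A ih =>
    obtain ⟨k, hk, H⟩ := ih
    rcases zmod_two_cases (x A) with h | h
    · refine ⟨k, by rw [pow_succ]; omega, fun i hi => ?_⟩
      rcases Nat.lt_succ_iff_lt_or_eq.1 hi with hi | rfl
      · exact H i hi
      · rw [h, digitPt, Nat.testBit_lt_two_pow hk]; simp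
    · refine ⟨2 ^ A * 1 + k, by rw [pow_succ]; omega, fun i hi => ?_⟩
      rw [digitPt, Nat.testBit_two_pow_mul_add 1 hk]
      rcases Nat.lt_succ_iff_lt_or_eq.1 hi with hi | rfl
      · rw [if_pos hi, H i hi, digitPt]
      · simp [h]

/-- The weights of the translates of dyadic kernels majorizing the Cesàro kernels. -/
def shiftWeight (α : ℝ) (k : ℕ) : ℝ :=
  if k = 0 then 1 else
    (2 : ℝ) ^ (-(1 + α) * (Nat.log 2 k : ℝ)) * ∑ j ∈ Finset.range (Nat.log 2 k + 1),
      2 ^ j * (if k < 2 ^ Nat.log 2 k + 2 ^ (Nat.log 2 k - j) then 1 else 0)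

lemma shiftWeight_nonneg (α : ℝ) (k : ℕ) : 0 ≤ shiftWeight α k := by
  unfold shiftWeight
  split_ifs
  · norm_num
  · refine mul_nonneg (by positivity) (Finset.sum_nonneg fun j _ => ?_)
    split_ifs <;> positivity

lemma abs_block_le {α : ℝ} (h0 : 0 < α) (h1 : α ≤ 1) {A R m k : ℕ} (hm : m ≤ 2 ^ A)
    (hmR : m ≤ R + 1) {x : WG} (hk : k < 2 ^ A) (hx : ∀ i < A, x i = digitPt k i) :
    |∑ l ∈ Finset.range m, Abin (α - 1) (R - l) * dirK (2 ^ A + l) x|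
      ≤ 8 * ((2 : ℝ) ^ α) ^ A * 2 ^ A * shiftWeight α k := by
  have hm1 : -1 ≤ α - 1 := by linarith
  have hpow : ∀ N : ℕ, (((2 ^ N : ℕ) : ℝ)) ^ α = ((2 : ℝ) ^ α) ^ N := by
    intro N
    rw [Nat.cast_pow, ← Real.rpow_natCast, ← Real.rpow_natCast, ← Real.rpow_mul (by norm_num),
      ← Real.rpow_mul (by norm_num), mul_comm]; norm_num
  have hsum0 : 0 ≤ ∑ l ∈ Finset.range m, Abin (α - 1) (R - l) :=
    Finset.sum_nonneg fun l _ => Abin_nonneg hm1 _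
  have hsum : ∑ l ∈ Finset.range m, Abin (α - 1) (R - l) ≤ 2 * ((2 : ℝ) ^ α) ^ A := by
    rw [← hpow, Finset.range_eq_Ico]
    exact sum_window_Abin_le h0 h1 (by positivity) (by omega) hmR (by omega)
  have hsplit : ∑ l ∈ Finset.range m, Abin (α - 1) (R - l) * dirK (2 ^ A + l) x =
      dirK (2 ^ A) x * ∑ l ∈ Finset.range m, Abin (α - 1) (R - l) +
        rad A x * ∑ l ∈ Finset.range m, Abin (α - 1) (R - l) * dirW l (tau A x) := by
    rw [Finset.mul_sum, Finset.mul_sum, ← Finset.sum_add_distrib]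
    refine Finset.sum_congr rfl fun l hl => ?_
    rw [dirK_two_pow_add ((Finset.mem_range.1 hl).le.trans hm)]; ring
  rw [hsplit]
  refine (abs_add_le _ _).trans ?_
  rw [abs_mul (rad A x), abs_rad, one_mul]
  rcases eq_or_ne k 0 with rfl | hk0
  · have hw : shiftWeight α 0 = 1 := by simp [shiftWeight]
    have hx0 : ∀ i < A, x i = 0 := fun i hi => by rw [hx i hi]; simp [digitPt]
    rw [hw, dirK_two_pow, if_pos hx0, abs_of_nonneg (by positivity)]
    have h2 : |∑ l ∈ Finset.range m, Abin (α - 1) (R - l) * dirW l (tau A x)| ≤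
        (∑ l ∈ Finset.range m, Abin (α - 1) (R - l)) * 2 ^ A := by
      refine (Finset.abs_sum_le_sum_abs _ _).trans ?_
      rw [Finset.sum_mul]
      refine Finset.sum_le_sum fun l hl => ?_
      rw [abs_mul, abs_of_nonneg (Abin_nonneg hm1 _)]
      refine mul_le_mul_of_nonneg_left ((abs_dirW_le _ _).trans ?_) (Abin_nonneg hm1 _)
      exact_mod_cast (Finset.mem_range.1 hl).le.trans hm
    have h3 := mul_le_mul_of_nonneg_right hsum (by positivity : (0 : ℝ) ≤ 2 ^ A)
    have h4 : 0 ≤ ((2 : ℝ) ^ α) ^ A * 2 ^ A := by positivity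
    linarith
  · set u := Nat.log 2 k with hu
    have huk : 2 ^ u ≤ k := Nat.pow_log_le_self 2 hk0
    have hku : k < 2 ^ (u + 1) := Nat.lt_pow_succ_log_self (by norm_num) k
    have huA : u < A := (Nat.pow_lt_pow_iff_right (by norm_num : 1 < 2)).1 (huk.trans_lt hk)
    have hbu : k.testBit u = true := by
      have e : k = 2 ^ u * 1 + (k - 2 ^ u) := by omega
      rw [e, Nat.testBit_two_pow_mul_add 1 (by rw [pow_succ] at hku; omega)]; simp
    have hxu : x u = 1 := by rw [hx u huA]; simp [digitPt, hbu]
    have hD : dirK (2 ^ A) x = 0 := by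
      rw [dirK_two_pow, if_neg]
      intro H
      have := H u huA
      rw [hxu] at this
      exact absurd this (by decide)
    rw [hD, zero_mul, abs_zero, zero_add]
    set s := A - 1 - u with hs
    have hsA : s + 1 + u = A := by omega
    have hy0 : ∀ i < s, tau A x i = 0 := by
      intro i hi
      rw [tau, if_pos (by omega), hx _ (by omega), digitPt, Nat.testBit_lt_two_pow]
      · simp
      · exact hku.trans_le (Nat.pow_le_pow_right (by norm_num) (by omega))
    have hy1 : tau A x s = 1 := by
      rw [tau, if_pos (by omega), show A - 1 - s = u by omega, hxu]
    have hW : ∀ p q, p ≤ q → q ≤ m → q ≤ p + 2 ^ (s + 1) →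
        ∑ l ∈ Finset.Ico p q, Abin (α - 1) (R - l) ≤ 2 * ((2 : ℝ) ^ α) ^ (s + 1) := by
      intro p q hpq hqm hq
      rw [← hpow]
      exact sum_window_Abin_le h0 h1 (by positivity) hpq (by omega) hq
    have hmain := abs_sum_mul_dirW_le hy0 hy1 (a := fun l => Abin (α - 1) (R - l))
      (fun l l' hl => Abin_antitone hm1 (by linarith) (by omega)) (Abin_nonneg hm1 _)
      (J := u) (m := m) (by rw [hsA]; exact hm) hW
    have hmaj : dirMaj u (wshift (s + 1) (tau A x)) ≤ ∑ j ∈ Finset.range (u + 1),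
        2 ^ j * (if k < 2 ^ u + 2 ^ (u - j) then 1 else 0) := by
      unfold dirMaj
      refine Finset.sum_le_sum fun j hj => mul_le_mul_of_nonneg_left ?_ (by positivity)
      have hj' : j ≤ u := Nat.lt_succ_iff.1 (Finset.mem_range.1 hj)
      split_ifs with hz hlt
      · exact le_rfl
      · exfalso
        apply hlt
        have : k - 2 ^ u < 2 ^ (u - j) := by
          apply Nat.lt_pow_two_of_testBit
          intro i hi
          rcases lt_or_ge i u with hiu | hiu
          · have e : k = 2 ^ u * 1 + (k - 2 ^ u) := by omega
            have hbit : k.testBit i = (k - 2 ^ u).testBit i := by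
              conv_lhs => rw [e, Nat.testBit_two_pow_mul_add 1 (by rw [pow_succ] at hku; omega)]
              rw [if_pos hiu]
            have hzi := hz (u - 1 - i) (by omega)
            rw [wshift, tau, if_pos (by omega),
              show A - 1 - (u - 1 - i + (s + 1)) = i by omega, hx i (by omega), digitPt] at hzi
            rw [← hbit]
            by_contra hb
            simp [hb] at hzi
          · apply Nat.testBit_lt_two_pow
            have : 2 ^ u ≤ 2 ^ i := Nat.pow_le_pow_right (by norm_num) hiu
            rw [pow_succ] at hku
            omega
        omega
      · norm_num
      · exact le_rfl
    have hw : shiftWeight α k = (2 : ℝ) ^ (-(1 + α) * (u : ℝ)) * ∑ j ∈ Finset.range (u + 1),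
        2 ^ j * (if k < 2 ^ u + 2 ^ (u - j) then 1 else 0) := by
      rw [shiftWeight, if_neg hk0]
    set G := ∑ j ∈ Finset.range (u + 1),
        (2 : ℝ) ^ j * (if k < 2 ^ u + 2 ^ (u - j) then 1 else 0) with hG
    have hG0 : 0 ≤ G := (zero_le_one.trans (one_le_dirMaj _ _)).trans hmaj
    have hu2 : (2 : ℝ) ^ (-(1 + α) * (u : ℝ)) = (2 ^ u * ((2 : ℝ) ^ α) ^ u)⁻¹ := by
      rw [← Real.rpow_natCast (2 ^ α), ← Real.rpow_mul (by norm_num), ← Real.rpow_natCast,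
        ← Real.rpow_add (by norm_num), ← Real.rpow_neg (by norm_num)]
      congr 1; ring
    rw [hw, hu2]
    refine hmain.trans ((mul_le_mul_of_nonneg_left hmaj (by positivity)).trans ?_)
    have h2a : (0 : ℝ) < 2 ^ α := by positivity
    have e : 8 * ((2 : ℝ) ^ α) ^ A * 2 ^ A *
        ((2 ^ u * ((2 : ℝ) ^ α) ^ u)⁻¹ * G) = 16 * 2 ^ s * ((2 : ℝ) ^ α) ^ (s + 1) * G := by
      rw [← hsA, pow_add _ (s + 1) u, pow_add _ (s + 1) u, pow_succ (2 : ℝ) s]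
      field_simp
      ring
    rw [e]
    have : 0 ≤ 2 ^ s * ((2 : ℝ) ^ α) ^ (s + 1) * G := by positivity
    linarith

lemma sum_range_two_pow (F : ℕ → ℝ) (M : ℕ) :
    ∑ k ∈ Finset.range (2 ^ M), F k =
      F 0 + ∑ A ∈ Finset.range M, ∑ l ∈ Finset.range (2 ^ A), F (2 ^ A + l) := by
  induction M with
  | zero => simp
  | succ M ih =>
    rw [pow_succ, mul_two, Finset.sum_range_add, ih, Finset.sum_range_succ, add_assoc]

/-- The kernel `dirK (2 ^ A)` is a normalized indicator of a dyadic interval; the Cesàro kernels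
are majorized by a superposition of its translates. -/
lemma abs_KK_le {α : ℝ} (h0 : 0 < α) (h1 : α ≤ 1) {n M : ℕ} (hn : n < 2 ^ M) (x : WG) :
    |KK α n x| ≤ ((n : ℝ) + 1) ^ (-α) * ∑ A ∈ Finset.range M, 8 * ((2 : ℝ) ^ α) ^ A *
      ∑ k ∈ Finset.range (2 ^ A), shiftWeight α k * dirK (2 ^ A) (x + digitPt k) := by
  have hA : ((n : ℝ) + 1) ^ α ≤ Abin α n := rpow_le_Abin h0 h1 n
  have hpos : 0 < ((n : ℝ) + 1) ^ α := by positivity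
  have hinv : (Abin α n)⁻¹ ≤ ((n : ℝ) + 1) ^ (-α) := by
    rw [Real.rpow_neg (by positivity)]
    exact inv_anti₀ hpos hA
  rw [KK, abs_mul, abs_of_nonneg (inv_nonneg.2 (hpos.le.trans hA))]
  refine mul_le_mul hinv ?_ (abs_nonneg _) (by positivity)
  set F : ℕ → ℝ := fun k => if k ≤ n then Abin (α - 1) (n - k) * dirK k x else 0 with hF
  have hFsum : ∑ k ∈ Finset.range (n + 1), Abin (α - 1) (n - k) * dirK k x =
      ∑ k ∈ Finset.range (2 ^ M), F k := by
    have hsub : Finset.range (n + 1) ⊆ Finset.range (2 ^ M) := by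
      intro k hk; rw [Finset.mem_range] at *; omega
    rw [← Finset.sum_subset hsub]
    · refine Finset.sum_congr rfl fun k hk => ?_
      rw [hF]; simp only; rw [if_pos]; have := Finset.mem_range.1 hk; omega
    · intro k _ hk
      rw [hF]; simp only; rw [if_neg]; intro h; exact hk (Finset.mem_range.2 (by omega))
  have hF0 : F 0 = 0 := by simp [hF, dirK]
  rw [hFsum, sum_range_two_pow, hF0, zero_add]
  refine (Finset.abs_sum_le_sum_abs _ _).trans (Finset.sum_le_sum fun A _ => ?_)
  obtain ⟨k, hk, hx⟩ := exists_digits A x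
  have hnn : ∀ k, 0 ≤ shiftWeight α k * dirK (2 ^ A) (x + digitPt k) := fun k =>
    mul_nonneg (shiftWeight_nonneg α k) (by rw [dirK_two_pow]; split_ifs <;> positivity)
  have hsingle : 2 ^ A * shiftWeight α k ≤
      ∑ k ∈ Finset.range (2 ^ A), shiftWeight α k * dirK (2 ^ A) (x + digitPt k) := by
    refine le_trans (le_of_eq ?_) (Finset.single_le_sum (fun k _ => hnn k) (Finset.mem_range.2 hk))
    rw [dirK_two_pow, if_pos, mul_comm]
    intro i hi
    rw [Pi.add_apply, hx i hi]
    rcases zmod_two_cases (digitPt k i) with h | h <;> rw [h] <;> decide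
  refine le_trans ?_ (mul_le_mul_of_nonneg_left hsingle (by positivity))
  rw [← mul_assoc]
  rcases le_or_gt (2 ^ A) n with hAn | hAn
  · have hm : min (2 ^ A) (n - 2 ^ A + 1) ≤ 2 ^ A := min_le_left _ _
    have := abs_block_le h0 h1 (R := n - 2 ^ A) hm (min_le_right _ _) hk hx
    have e : ∑ l ∈ Finset.range (2 ^ A), F (2 ^ A + l) =
        ∑ l ∈ Finset.range (min (2 ^ A) (n - 2 ^ A + 1)),
          Abin (α - 1) (n - 2 ^ A - l) * dirK (2 ^ A + l) x := by
      rw [← Finset.sum_subset (Finset.range_mono hm)]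
      · refine Finset.sum_congr rfl fun l hl => ?_
        have := lt_min_iff.1 (Finset.mem_range.1 hl)
        rw [hF]; simp only; rw [if_pos (by omega), Nat.sub_sub]
      · intro l hl hl'
        rw [Finset.mem_range] at hl hl'
        rw [hF]; simp only; rw [if_neg]
        intro h; exact hl' (lt_min hl (by omega))
    rw [e]
    exact this
  · rw [Finset.sum_eq_zero]
    · rw [abs_zero]
      exact mul_nonneg (by positivity) (shiftWeight_nonneg _ _)
    · intro l _
      rw [hF]; simp only; rw [if_neg]; omega

end KaczmarzKernel

section Orthogonality

instance : IsProbabilityMeasure μW := ⟨by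
  unfold μW
  rw [← TopologicalSpace.PositiveCompacts.coe_top (α := WG)]
  exact Measure.addHaarMeasure_self⟩

instance : μW.IsAddHaarMeasure := by unfold μW; infer_instance

instance (d : ℕ) : IsProbabilityMeasure (μD d) := by unfold μD; infer_instance

instance (d : ℕ) : (μD d).IsAddHaarMeasure := by unfold μD; infer_instance

instance (d : ℕ) : (μD d).Regular := by
  exact Measure.Regular.of_sigmaCompactSpace_of_isLocallyFiniteMeasure (μD d)

lemma continuous_kacz (n : ℕ) : Continuous (kacz n) := by
  have hval : ∀ k : ℕ, Continuous fun x : WG => (x k).val := fun k =>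
    (continuous_of_discreteTopology (f := fun a : ZMod 2 => a.val)).comp (continuous_apply k)
  have hpow : Continuous fun k : ℕ => (-1 : ℝ) ^ k := continuous_of_discreteTopology
  unfold kacz rad
  split_ifs
  · exact continuous_const
  · exact (hpow.comp (hval _)).mul (hpow.comp
      (continuous_finsetSum _ fun k _ => continuous_const.mul (hval _)))

lemma integrable_of_continuous_compact {X : Type*} [TopologicalSpace X] [CompactSpace X]
    [MeasurableSpace X] [OpensMeasurableSpace X] {μ : Measure X} [IsFiniteMeasureOnCompacts μ]
    {f : X → ℝ} (hf : Continuous f) : Integrable f μ :=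
  hf.integrable_of_hasCompactSupport (HasCompactSupport.of_compactSpace f)

lemma integral_eq_zero_of_shift {χ : WG → ℝ} {h : WG} (hχ : ∀ x, χ (x + h) = -χ x) :
    ∫ x, χ x ∂μW = 0 := by
  have := integral_add_right_eq_self (μ := μW) χ h
  simp only [hχ, integral_neg] at this
  linarith

lemma kacz_eq_one_or (n : ℕ) (x : WG) : kacz n x = 1 ∨ kacz n x = -1 :=
  (abs_eq zero_le_one).1 (abs_kacz n x)

lemma integral_kacz {n : ℕ} (hn : n ≠ 0) : ∫ x, kacz n x ∂μW = 0 := by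
  obtain ⟨A, l, hl, rfl⟩ := exists_two_pow_add hn
  refine integral_eq_zero_of_shift (h := Pi.single A 1) fun x => ?_
  rw [kacz_add, kacz_two_pow_add hl (Pi.single A 1), rad_of_one (by simp), walsh_of_zeros hl]
  · ring
  · rw [tau_zeros_iff]
    intro i hi
    rw [Pi.single_eq_of_ne (by omega)]

lemma integral_dirK_two_pow (M : ℕ) : ∫ x, dirK (2 ^ M) x ∂μW = 1 := by
  unfold dirK
  rw [integral_finsetSum _ fun k _ => integrable_of_continuous_compact (continuous_kacz k),
    Finset.sum_eq_single_of_mem 0 (by simp) fun k _ hk => integral_kacz hk]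
  simp [kacz]

lemma integral_kacz_mul_nonneg (m n : ℕ) : 0 ≤ ∫ x, kacz m x * kacz n x ∂μW := by
  by_cases H : ∃ h, kacz m h * kacz n h = -1
  · obtain ⟨h, hh⟩ := H
    refine (integral_eq_zero_of_shift (h := h) fun x => ?_).ge
    rw [kacz_add, kacz_add, mul_mul_mul_comm, hh]; ring
  · refine integral_nonneg fun x => ?_
    have : kacz m x * kacz n x ≠ -1 := fun h => H ⟨x, h⟩
    rcases kacz_eq_one_or m x with h1 | h1 <;> rcases kacz_eq_one_or n x with h2 | h2 <;>
      simp_all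

lemma kacz_of_zeros {n M : ℕ} (hn : n < 2 ^ M) {x : WG} (hx : ∀ i < M, x i = 0) :
    kacz n x = 1 := by
  rcases eq_or_ne n 0 with rfl | h0
  · simp [kacz]
  · obtain ⟨A, l, hl, rfl⟩ := exists_two_pow_add h0
    have hA : A < M := (Nat.pow_lt_pow_iff_right (by norm_num : 1 < 2)).1 (by omega)
    rw [kacz_two_pow_add hl, rad_of_zero (hx A hA), walsh_of_zeros hl, one_mul]
    rw [tau_zeros_iff]
    exact fun i hi => hx i (by omega)

lemma kacz_mul_self (n : ℕ) (x : WG) : kacz n x * kacz n x = 1 := by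
  rcases kacz_eq_one_or n x with h | h <;> simp [h]

lemma integral_kacz_mul (m n : ℕ) : ∫ x, kacz m x * kacz n x ∂μW = if m = n then 1 else 0 := by
  split_ifs with hmn
  · subst hmn
    simp [kacz_mul_self]
  obtain ⟨M, hM⟩ : ∃ M, max m n < 2 ^ M := ⟨_, Nat.lt_two_pow_self⟩
  have hm : m ∈ Finset.range (2 ^ M) := Finset.mem_range.2 ((le_max_left _ _).trans_lt hM)
  have hn : n ∈ Finset.range (2 ^ M) := Finset.mem_range.2 ((le_max_right _ _).trans_lt hM)
  have hsum : ∑ k ∈ Finset.range (2 ^ M), ∫ x, kacz k x * kacz n x ∂μW = 1 := by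
    rw [← integral_finsetSum (Finset.range (2 ^ M)) (f := fun k x => kacz k x * kacz n x) fun k _ =>
      integrable_of_continuous_compact ((continuous_kacz k).mul (continuous_kacz n)),
      ← integral_dirK_two_pow M]
    refine integral_congr_ae (Eventually.of_forall fun x => ?_)
    simp only [← Finset.sum_mul]
    change dirK (2 ^ M) x * _ = dirK (2 ^ M) x
    by_cases hx : ∀ i < M, x i = 0
    · rw [kacz_of_zeros (Finset.mem_range.1 hn) hx, mul_one]
    · rw [dirK_two_pow, if_neg hx, zero_mul]
  rw [← Finset.add_sum_erase _ _ hn] at hsum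
  have hnn : ∫ x, kacz n x * kacz n x ∂μW = 1 := by simp [kacz_mul_self]
  have h1 := Finset.single_le_sum (f := fun k => ∫ x, kacz k x * kacz n x ∂μW)
    (fun k _ => integral_kacz_mul_nonneg k n) (Finset.mem_erase.2 ⟨hmn, hm⟩)
  have h2 := integral_kacz_mul_nonneg m n
  linarith

variable {d : ℕ}

lemma continuous_kaczD (m : Fin d → ℕ) : Continuous (kaczD d m) :=
  continuous_finsetProd _ fun i _ => (continuous_kacz (m i)).comp (continuous_apply i)

lemma kaczD_add (m : Fin d → ℕ) (x y : Fin d → WG) :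
    kaczD d m (x + y) = kaczD d m x * kaczD d m y := by
  simp only [kaczD, Pi.add_apply, kacz_add, Finset.prod_mul_distrib]

lemma abs_kaczD (m : Fin d → ℕ) (x : Fin d → WG) : |kaczD d m x| = 1 := by
  rw [kaczD, Finset.abs_prod]
  exact Finset.prod_eq_one fun i _ => abs_kacz _ _

lemma integral_kaczD_mul (m n : Fin d → ℕ) :
    ∫ x, kaczD d m x * kaczD d n x ∂μD d = if m = n then 1 else 0 := by
  simp only [kaczD, ← Finset.prod_mul_distrib]
  unfold μD
  rw [integral_fintype_prod_eq_prod (fun i x => kacz (m i) x * kacz (n i) x)]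
  simp only [integral_kacz_mul]
  split_ifs with h
  · subst h; simp
  · obtain ⟨i, hi⟩ := Function.ne_iff.1 h
    exact Finset.prod_eq_zero (Finset.mem_univ i) (if_neg hi)

end Orthogonality

section DyadicAverages

variable {d : ℕ}

/-- The kernel of the dyadic conditional expectation of multi-level `N`. -/
def dyK (N : Fin d → ℕ) (y : Fin d → WG) : ℝ := ∏ i, dirK (2 ^ N i) (y i)

lemma dyK_eq_sum (N : Fin d → ℕ) (y : Fin d → WG) :
    dyK N y = ∑ m ∈ Fintype.piFinset (fun i => Finset.range (2 ^ N i)), kaczD d m y := by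
  simp only [dyK, dirK, kaczD]
  exact Finset.prod_univ_sum _ _

lemma dirK_two_pow_nonneg (A : ℕ) (x : WG) : 0 ≤ dirK (2 ^ A) x := by
  rw [dirK_two_pow]
  split_ifs <;> positivity

lemma dyK_nonneg (N : Fin d → ℕ) (y : Fin d → WG) : 0 ≤ dyK N y :=
  Finset.prod_nonneg fun _ _ => dirK_two_pow_nonneg _ _

lemma continuous_dyK (N : Fin d → ℕ) : Continuous (dyK N) := by
  simp only [funext (dyK_eq_sum N)]
  exact continuous_finsetSum _ fun m _ => continuous_kaczD m

lemma dyK_add_of_zeros {N : Fin d → ℕ} {h : Fin d → WG} (hh : ∀ i, ∀ j < N i, h i j = 0)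
    (y : Fin d → WG) : dyK N (y + h) = dyK N y := by
  refine Finset.prod_congr rfl fun i _ => ?_
  rw [dirK_two_pow, dirK_two_pow]
  refine if_congr ?_ rfl rfl
  refine forall_congr' fun j => imp_congr_right fun hj => ?_
  simp [hh i j hj]

lemma zeros_of_dyK_ne_zero {N : Fin d → ℕ} {y : Fin d → WG} (hy : dyK N y ≠ 0) (i : Fin d) :
    ∀ j < N i, y i j = 0 := by
  have := Finset.prod_ne_zero_iff.1 hy i (Finset.mem_univ i)
  rw [dirK_two_pow] at this
  by_contra h
  exact this (if_neg h)

lemma lintegral_dyK (N : Fin d → ℕ) : ∫⁻ y, ENNReal.ofReal (dyK N y) ∂μD d = 1 := by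
  rw [← ofReal_integral_eq_lintegral_ofReal
    (integrable_of_continuous_compact (continuous_dyK N)) (Eventually.of_forall (dyK_nonneg N))]
  unfold dyK μD
  rw [integral_fintype_prod_eq_prod (fun i x => dirK (2 ^ N i) x)]
  simp [integral_dirK_two_pow]

lemma wg_add_self (x : Fin d → WG) : x + x = 0 := by
  funext i j
  exact CharTwo.add_self_eq_zero (x i j)

/-- The dyadic average of multi-level `N` of a nonnegative function. -/
def dyAvg (N : Fin d → ℕ) (g : (Fin d → WG) → ℝ≥0∞) (x : Fin d → WG) : ℝ≥0∞ :=
  ∫⁻ t, g t * ENNReal.ofReal (dyK N (x + t)) ∂μD d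

lemma measurable_dyK_add (N : Fin d → ℕ) : Measurable fun p : (Fin d → WG) × (Fin d → WG) =>
    ENNReal.ofReal (dyK N (p.1 + p.2)) :=
  ENNReal.measurable_ofReal.comp ((continuous_dyK N).comp continuous_add).measurable

lemma measurable_dyK_add_left (N : Fin d → ℕ) (t : Fin d → WG) :
    Measurable fun x : Fin d → WG => ENNReal.ofReal (dyK N (x + t)) :=
  ENNReal.measurable_ofReal.comp ((continuous_dyK N).comp (continuous_add_const t)).measurable

lemma measurable_dyK_add_right (N : Fin d → ℕ) (x : Fin d → WG) :
    Measurable fun t : Fin d → WG => ENNReal.ofReal (dyK N (x + t)) :=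
  ENNReal.measurable_ofReal.comp ((continuous_dyK N).comp (continuous_const_add x)).measurable

lemma measurable_dyAvg (N : Fin d → ℕ) {g : (Fin d → WG) → ℝ≥0∞} (hg : Measurable g) :
    Measurable (dyAvg N g) :=
  Measurable.lintegral_prod_right' (f := fun p : (Fin d → WG) × (Fin d → WG) =>
    g p.2 * ENNReal.ofReal (dyK N (p.1 + p.2)))
    ((hg.comp measurable_snd).mul (measurable_dyK_add N))

lemma dyAvg_add_of_zeros {N : Fin d → ℕ} {h : Fin d → WG} (hh : ∀ i, ∀ j < N i, h i j = 0)
    (g : (Fin d → WG) → ℝ≥0∞) (x : Fin d → WG) : dyAvg N g (x + h) = dyAvg N g x := by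
  unfold dyAvg
  simp only [add_right_comm x h, dyK_add_of_zeros hh]

lemma lintegral_dyK_add (N : Fin d → ℕ) (t : Fin d → WG) :
    ∫⁻ x, ENNReal.ofReal (dyK N (x + t)) ∂μD d = 1 := by
  rw [lintegral_add_right_eq_self (μ := μD d) (fun x => ENNReal.ofReal (dyK N x)) t,
    lintegral_dyK]

lemma setLIntegral_dyAvg {N : Fin d → ℕ} {g : (Fin d → WG) → ℝ≥0∞} (hg : Measurable g)
    {B : Set (Fin d → WG)} (hB : MeasurableSet B)
    (hinv : ∀ h : Fin d → WG, (∀ i, ∀ j < N i, h i j = 0) → ∀ x, x + h ∈ B ↔ x ∈ B) :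
    ∫⁻ x in B, dyAvg N g x ∂μD d = ∫⁻ x in B, g x ∂μD d := by
  have key : ∀ x t, B.indicator (fun _ => (1 : ℝ≥0∞)) x *
      (g t * ENNReal.ofReal (dyK N (x + t))) =
      B.indicator g t * ENNReal.ofReal (dyK N (x + t)) := by
    intro x t
    by_cases h0 : dyK N (x + t) = 0
    · simp [h0]
    · have hz := zeros_of_dyK_ne_zero h0
      have h1 := hinv _ hz x
      rw [← add_assoc, wg_add_self, zero_add] at h1
      by_cases hx : x ∈ B
      · rw [Set.indicator_of_mem hx, Set.indicator_of_mem (h1.2 hx), one_mul]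
      · rw [Set.indicator_of_notMem hx, Set.indicator_of_notMem (fun h => hx (h1.1 h)), zero_mul,
          zero_mul]
  calc ∫⁻ x in B, dyAvg N g x ∂μD d
      = ∫⁻ x, ∫⁻ t, B.indicator g t * ENNReal.ofReal (dyK N (x + t)) ∂μD d ∂μD d := by
        rw [← lintegral_indicator hB]
        refine lintegral_congr fun x => ?_
        simp_rw [← key]
        rw [lintegral_const_mul]
        · by_cases hx : x ∈ B <;> simp [hx, dyAvg]
        · exact hg.mul (measurable_dyK_add_right N x)
    _ = ∫⁻ t, ∫⁻ x, B.indicator g t * ENNReal.ofReal (dyK N (x + t)) ∂μD d ∂μD d := by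
        refine lintegral_lintegral_swap ?_
        exact (((hg.indicator hB).comp measurable_snd).mul (measurable_dyK_add N)).aemeasurable
    _ = ∫⁻ x in B, g x ∂μD d := by
        rw [← lintegral_indicator hB]
        refine lintegral_congr fun t => ?_
        rw [lintegral_const_mul _ (measurable_dyK_add_left N t), lintegral_dyK_add, mul_one]

/-- Doob's weak type inequality for dyadic averages along an increasing chain of levels. -/
lemma mul_measure_iUnion_dyAvg_le {N : ℕ → Fin d → ℕ} (hN : Monotone N)
    {g : (Fin d → WG) → ℝ≥0∞} (hg : Measurable g) (l : ℝ≥0∞) :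
    l * μD d (⋃ m, {x | l < dyAvg (N m) g x}) ≤ ∫⁻ x, g x ∂μD d := by
  set A : ℕ → Set (Fin d → WG) := fun m => {x | l < dyAvg (N m) g x} with hA
  have hAm : ∀ m, MeasurableSet (A m) := fun m =>
    measurableSet_lt measurable_const (measurable_dyAvg _ hg)
  have hBm : ∀ m, MeasurableSet (disjointed A m) := fun m =>
    MeasurableSet.disjointed hAm m
  have hAinv : ∀ m k, k ≤ m → ∀ h : Fin d → WG, (∀ i, ∀ j < N m i, h i j = 0) →
      ∀ x, x + h ∈ A k ↔ x ∈ A k := by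
    intro m k hk h hh x
    simp only [hA, Set.mem_ofPred_eq]
    rw [dyAvg_add_of_zeros fun i j hj => hh i j (hj.trans_le (hN hk i))]
  have hBinv : ∀ m, ∀ h : Fin d → WG, (∀ i, ∀ j < N m i, h i j = 0) →
      ∀ x, x + h ∈ disjointed A m ↔ x ∈ disjointed A m := by
    intro m h hh x
    rw [disjointed_eq_inter_compl]
    simp only [Set.mem_inter_iff, Set.mem_iInter, Set.mem_compl_iff]
    rw [hAinv m m le_rfl h hh x]
    refine and_congr_right fun _ => forall_congr' fun k => imp_congr_right fun hk => ?_
    rw [hAinv m k hk.le h hh x]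
  calc l * μD d (⋃ m, A m) = ∑' m, l * μD d (disjointed A m) := by
        rw [← iUnion_disjointed, measure_iUnion (disjoint_disjointed A) hBm, ENNReal.tsum_mul_left]
    _ ≤ ∑' m, ∫⁻ x in disjointed A m, g x ∂μD d := by
        refine ENNReal.tsum_le_tsum fun m => ?_
        rw [← setLIntegral_dyAvg hg (hBm m) (hBinv m), ← setLIntegral_const]
        exact setLIntegral_mono (measurable_dyAvg _ hg) fun x hx =>
          (disjointed_subset A m hx : x ∈ A m).le
    _ = ∫⁻ x in ⋃ m, disjointed A m, g x ∂μD d :=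
        (lintegral_iUnion hBm (disjoint_disjointed A) _).symm
    _ ≤ ∫⁻ x, g x ∂μD d := setLIntegral_le_lintegral _ _

end DyadicAverages

section WeakType

lemma summable_shiftWeight {α : ℝ} (h0 : 0 < α) : Summable (shiftWeight α) := by
  have hr : ‖(2 : ℝ) ^ (-α)‖ < 1 := by
    rw [Real.norm_of_nonneg (by positivity)]
    exact Real.rpow_lt_one_of_one_lt_of_neg (by norm_num) (by linarith)
  have hblock : ∀ A : ℕ, ∑ l ∈ Finset.range (2 ^ A), shiftWeight α (2 ^ A + l) =
      (A : ℝ) ^ 1 * ((2 : ℝ) ^ (-α)) ^ A + ((2 : ℝ) ^ (-α)) ^ A := by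
    intro A
    have h1 : ∀ l ∈ Finset.range (2 ^ A), shiftWeight α (2 ^ A + l) =
        (2 : ℝ) ^ (-(1 + α) * (A : ℝ)) * ∑ j ∈ Finset.range (A + 1),
          2 ^ j * (if l < 2 ^ (A - j) then 1 else 0) := by
      intro l hl
      rw [shiftWeight, if_neg (by positivity), log_two_pow_add (Finset.mem_range.1 hl)]
      simp
    rw [Finset.sum_congr rfl h1, ← Finset.mul_sum, Finset.sum_comm]
    have h2 : ∀ j ∈ Finset.range (A + 1), ∑ l ∈ Finset.range (2 ^ A),
        (2 : ℝ) ^ j * (if l < 2 ^ (A - j) then 1 else 0) = 2 ^ A := by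
      intro j hj
      have hj' : j ≤ A := by simpa [Nat.lt_succ_iff] using hj
      rw [← Finset.mul_sum, Finset.sum_boole]
      have : Finset.filter (fun l => l < 2 ^ (A - j)) (Finset.range (2 ^ A)) =
          Finset.range (2 ^ (A - j)) := by
        ext l
        have : 2 ^ (A - j) ≤ 2 ^ A := Nat.pow_le_pow_right (by norm_num) (by omega)
        simp only [Finset.mem_filter, Finset.mem_range]
        omega
      rw [this, Finset.card_range]
      push_cast
      rw [← pow_add]
      congr 1
      omega
    rw [Finset.sum_congr rfl h2, Finset.sum_const, Finset.card_range, nsmul_eq_mul]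
    have h3 : (2 : ℝ) ^ (-(1 + α) * (A : ℝ)) * 2 ^ A = ((2 : ℝ) ^ (-α)) ^ A := by
      rw [← Real.rpow_natCast, ← Real.rpow_natCast, ← Real.rpow_mul (by norm_num),
        ← Real.rpow_add (by norm_num)]
      congr 1
      ring
    push_cast
    rw [← h3]
    ring
  have hs : Summable fun A : ℕ => (A : ℝ) ^ 1 * ((2 : ℝ) ^ (-α)) ^ A + ((2 : ℝ) ^ (-α)) ^ A :=
    (summable_pow_mul_geometric_of_norm_lt_one 1 hr).add (summable_geometric_of_norm_lt_one hr)
  refine summable_of_sum_range_le (c := shiftWeight α 0 + ∑' A : ℕ,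
    ((A : ℝ) ^ 1 * ((2 : ℝ) ^ (-α)) ^ A + ((2 : ℝ) ^ (-α)) ^ A)) (shiftWeight_nonneg α) fun n => ?_
  have hn : n ≤ 2 ^ n := Nat.lt_two_pow_self.le
  refine (Finset.sum_le_sum_of_subset_of_nonneg (Finset.range_mono hn)
    fun k _ _ => shiftWeight_nonneg α k).trans ?_
  rw [sum_range_two_pow]
  simp only [hblock]
  gcongr
  exact hs.sum_le_tsum _ fun A _ => by positivity

lemma tsum_prod_le_prod_tsum {d : ℕ} (c : Fin d → ℕ → ℝ≥0∞) :
    ∑' s : Fin d → ℕ, ∏ i, c i (s i) ≤ ∏ i, ∑' a, c i a := by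
  rw [ENNReal.tsum_eq_iSup_sum]
  refine iSup_le fun S => ?_
  have hsub : S ⊆ Fintype.piFinset fun i : Fin d => S.image fun s : Fin d → ℕ => s i :=
    fun s hs => Fintype.mem_piFinset.2 fun i =>
      Finset.mem_image_of_mem (fun s : Fin d → ℕ => s i) hs
  refine (Finset.sum_le_sum_of_subset hsub).trans ?_
  rw [← Finset.prod_univ_sum]
  exact Finset.prod_le_prod' fun i _ => ENNReal.sum_le_tsum _

/-- The geometric ratio `2^{-α/2}`. -/
def halfRatio (α : ℝ) : ℝ≥0∞ := ENNReal.ofReal ((2 : ℝ) ^ (-(α / 2)))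

lemma halfRatio_pos (α : ℝ) : 0 < halfRatio α := ENNReal.ofReal_pos.2 (by positivity)

lemma halfRatio_lt_one {α : ℝ} (h0 : 0 < α) : halfRatio α < 1 := by
  rw [halfRatio, ENNReal.ofReal_lt_one]
  exact Real.rpow_lt_one_of_one_lt_of_neg (by norm_num) (by linarith)

lemma halfRatio_sq_pow (α : ℝ) (a : ℕ) :
    (halfRatio α ^ 2) ^ a = ENNReal.ofReal ((2 : ℝ) ^ (-α * a)) := by
  rw [halfRatio, ← pow_mul, ← ENNReal.ofReal_pow (by positivity)]
  congr 1
  rw [← Real.rpow_natCast, ← Real.rpow_mul (by norm_num)]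
  congr 1
  push_cast
  ring

lemma ofReal_abs_KK_le {α C : ℝ} (h0 : 0 < α) (h1 : α ≤ 1) {n M : ℕ} (hn : n < 2 ^ M)
    (hC : 1 ≤ C) (hM : (2 : ℝ) ^ M ≤ C * (n + 1)) (x : WG) :
    ENNReal.ofReal |KK α n x| ≤ ENNReal.ofReal (8 * C) * ∑ a ∈ Finset.range M,
      (halfRatio α ^ 2) ^ a * ∑ k ∈ Finset.range (2 ^ (M - 1 - a)),
        ENNReal.ofReal (shiftWeight α k) *
          ENNReal.ofReal (dirK (2 ^ (M - 1 - a)) (x + digitPt k)) := by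
  have hreal : |KK α n x| ≤ 8 * C * ∑ a ∈ Finset.range M, (2 : ℝ) ^ (-α * a) *
      ∑ k ∈ Finset.range (2 ^ (M - 1 - a)),
        shiftWeight α k * dirK (2 ^ (M - 1 - a)) (x + digitPt k) := by
    refine (abs_KK_le h0 h1 hn x).trans ?_
    rw [← Finset.sum_range_reflect, Finset.mul_sum, Finset.mul_sum]
    refine Finset.sum_le_sum fun a ha => ?_
    have haM : a < M := Finset.mem_range.1 ha
    have hnn : 0 ≤ ∑ k ∈ Finset.range (2 ^ (M - 1 - a)),
        shiftWeight α k * dirK (2 ^ (M - 1 - a)) (x + digitPt k) :=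
      Finset.sum_nonneg fun k _ => mul_nonneg (shiftWeight_nonneg _ _) (dirK_two_pow_nonneg _ _)
    rw [← mul_assoc, ← mul_assoc (8 * C)]
    refine mul_le_mul_of_nonneg_right ?_ hnn
    have hpos : (0 : ℝ) < (n : ℝ) + 1 := by positivity
    have hMα : (2 : ℝ) ^ (α * M) ≤ C * ((n : ℝ) + 1) ^ α := by
      calc (2 : ℝ) ^ (α * M) = ((2 : ℝ) ^ M) ^ α := by
            rw [mul_comm, Real.rpow_mul (by norm_num), Real.rpow_natCast]
        _ ≤ (C * (n + 1)) ^ α := Real.rpow_le_rpow (by positivity) hM h0.le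
        _ = C ^ α * ((n : ℝ) + 1) ^ α := Real.mul_rpow (by linarith) hpos.le
        _ ≤ C * ((n : ℝ) + 1) ^ α := by
            gcongr
            calc C ^ α ≤ C ^ (1 : ℝ) := Real.rpow_le_rpow_of_exponent_le hC h1
              _ = C := Real.rpow_one C
    have hexp : ((2 : ℝ) ^ α) ^ (M - 1 - a) ≤ (2 : ℝ) ^ (α * M) * (2 : ℝ) ^ (-α * a) := by
      rw [← Real.rpow_natCast, ← Real.rpow_mul (by norm_num), ← Real.rpow_add (by norm_num)]
      refine Real.rpow_le_rpow_of_exponent_le (by norm_num) ?_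
      have : ((M - 1 - a : ℕ) : ℝ) ≤ (M : ℝ) - a := by
        rw [Nat.sub_sub, Nat.cast_sub (by omega)]; push_cast; linarith
      nlinarith
    rw [Real.rpow_neg hpos.le]
    calc (((n : ℝ) + 1) ^ α)⁻¹ * (8 * ((2 : ℝ) ^ α) ^ (M - 1 - a))
        ≤ (((n : ℝ) + 1) ^ α)⁻¹ * (8 * (C * ((n : ℝ) + 1) ^ α * (2 : ℝ) ^ (-α * a))) := by
          gcongr
          exact hexp.trans (by gcongr)
      _ = 8 * C * (2 : ℝ) ^ (-α * a) := by
          have : ((n : ℝ) + 1) ^ α ≠ 0 := by positivity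
          field_simp
  refine (ENNReal.ofReal_le_ofReal hreal).trans_eq ?_
  have hterm : ∀ a k, 0 ≤ shiftWeight α k * dirK (2 ^ (M - 1 - a)) (x + digitPt k) := fun a k =>
    mul_nonneg (shiftWeight_nonneg _ _) (dirK_two_pow_nonneg _ _)
  rw [ENNReal.ofReal_mul (by linarith), ENNReal.ofReal_sum_of_nonneg fun a _ =>
    mul_nonneg (by positivity) (Finset.sum_nonneg fun k _ => hterm a k)]
  congr 1
  refine Finset.sum_congr rfl fun a _ => ?_
  rw [ENNReal.ofReal_mul (by positivity), halfRatio_sq_pow,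
    ENNReal.ofReal_sum_of_nonneg fun k _ => hterm a k]
  congr 1
  refine Finset.sum_congr rfl fun k _ => ?_
  rw [ENNReal.ofReal_mul (shiftWeight_nonneg _ _)]

end WeakType

section MaximalInequality

variable {d : ℕ}

/-- The translation point with digit expansions `k i` in the coordinates. -/
def digitPtD (k : Fin d → ℕ) : Fin d → WG := fun i => digitPt (k i)

/-- The average of the translates of `F` along the points `digitPtD k`. -/
def shiftAvg (α : Fin d → ℝ) (F : (Fin d → WG) → ℝ≥0∞) (t : Fin d → WG) : ℝ≥0∞ :=
  ∑' k : Fin d → ℕ, (∏ i, ENNReal.ofReal (shiftWeight (α i) (k i))) * F (t + digitPtD k)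

lemma prod_ofReal_abs_KK_le {α : Fin d → ℝ} (hα : ∀ i, 0 < α i ∧ α i ≤ 1) {C : ℝ} (hC : 1 ≤ C)
    {n M : Fin d → ℕ} (hn : ∀ i, n i < 2 ^ M i) (hM : ∀ i, (2 : ℝ) ^ M i ≤ C * (n i + 1))
    (y : Fin d → WG) :
    ∏ i, ENNReal.ofReal |KK (α i) (n i) (y i)| ≤ ENNReal.ofReal (8 * C) ^ d *
      ∑' a : Fin d → ℕ, (∏ i, (halfRatio (α i) ^ 2) ^ a i) *
        ∑' k : Fin d → ℕ, (∏ i, ENNReal.ofReal (shiftWeight (α i) (k i))) *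
          ENNReal.ofReal (dyK (fun i => M i - 1 - a i) (y + digitPtD k)) := by
  refine (Finset.prod_le_prod' fun i _ =>
    ofReal_abs_KK_le (hα i).1 (hα i).2 (hn i) hC (hM i) (y i)).trans ?_
  rw [Finset.prod_mul_distrib, Finset.prod_const, Finset.card_univ, Fintype.card_fin,
    Finset.prod_univ_sum]
  refine mul_le_mul_right ?_ _
  refine (Finset.sum_le_sum fun a _ => ?_).trans (ENNReal.sum_le_tsum _)
  rw [Finset.prod_mul_distrib, Finset.prod_univ_sum]
  refine mul_le_mul_right ?_ _
  refine (Finset.sum_le_sum fun k _ => ?_).trans (ENNReal.sum_le_tsum _)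
  rw [Finset.prod_mul_distrib, dyK,
    ENNReal.ofReal_prod_of_nonneg fun i _ => dirK_two_pow_nonneg _ _]
  exact le_rfl

lemma measurable_shiftAvg (α : Fin d → ℝ) {F : (Fin d → WG) → ℝ≥0∞} (hF : Measurable F) :
    Measurable (shiftAvg α F) := by
  refine Measurable.tsum fun k => Measurable.const_mul ?_ _
  exact hF.comp (measurable_add_const _)

lemma lintegral_shiftAvg (α : Fin d → ℝ) {F : (Fin d → WG) → ℝ≥0∞} (hF : Measurable F) :
    ∫⁻ t, shiftAvg α F t ∂μD d =
      (∑' k : Fin d → ℕ, ∏ i, ENNReal.ofReal (shiftWeight (α i) (k i))) * ∫⁻ t, F t ∂μD d := by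
  unfold shiftAvg
  have hm : ∀ k : Fin d → ℕ, Measurable fun t => F (t + digitPtD k) := fun k =>
    hF.comp (measurable_add_const _)
  rw [lintegral_tsum fun k => ((hm k).const_mul _).aemeasurable, ← ENNReal.tsum_mul_right]
  refine tsum_congr fun k => ?_
  rw [lintegral_const_mul _ (hm k), lintegral_add_right_eq_self (μ := μD d) F]

lemma lintegral_mul_shift_dyK (N : Fin d → ℕ) (F : (Fin d → WG) → ℝ≥0∞) (x z : Fin d → WG) :
    ∫⁻ t, F t * ENNReal.ofReal (dyK N (x + t + z)) ∂μD d =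
      ∫⁻ t, F (t + z) * ENNReal.ofReal (dyK N (x + t)) ∂μD d := by
  rw [← lintegral_add_right_eq_self (μ := μD d)
    (fun t => F t * ENNReal.ofReal (dyK N (x + t + z))) z]
  refine lintegral_congr fun t => ?_
  rw [show x + (t + z) + z = x + t + (z + z) by abel, wg_add_self, add_zero]

lemma lintegral_mul_prod_KK_le {α : Fin d → ℝ} (hα : ∀ i, 0 < α i ∧ α i ≤ 1) {C : ℝ} (hC : 1 ≤ C)
    {n M : Fin d → ℕ} (hn : ∀ i, n i < 2 ^ M i) (hM : ∀ i, (2 : ℝ) ^ M i ≤ C * (n i + 1))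
    {F : (Fin d → WG) → ℝ≥0∞} (hF : Measurable F) (x : Fin d → WG) :
    ∫⁻ t, F t * ∏ i, ENNReal.ofReal |KK (α i) (n i) (x i + t i)| ∂μD d ≤
      ENNReal.ofReal (8 * C) ^ d * ∑' a : Fin d → ℕ, (∏ i, (halfRatio (α i) ^ 2) ^ a i) *
        dyAvg (fun i => M i - 1 - a i) (shiftAvg α F) x := by
  have hD : ∀ (N : Fin d → ℕ) (z : Fin d → WG),
      Measurable fun t => ENNReal.ofReal (dyK N (x + t + z)) := fun N z =>
    ENNReal.measurable_ofReal.comp ((continuous_dyK N).comp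
      ((continuous_const_add x).add continuous_const)).measurable
  have hterm : ∀ a : Fin d → ℕ, Measurable fun t => F t * ((∏ i, (halfRatio (α i) ^ 2) ^ a i) *
        ∑' k : Fin d → ℕ, (∏ i, ENNReal.ofReal (shiftWeight (α i) (k i))) *
          ENNReal.ofReal (dyK (fun i => M i - 1 - a i) (x + t + digitPtD k))) := fun a =>
    hF.mul ((Measurable.tsum fun k => (hD _ _).const_mul _).const_mul _)
  calc ∫⁻ t, F t * ∏ i, ENNReal.ofReal |KK (α i) (n i) (x i + t i)| ∂μD d
      ≤ ∫⁻ t, ENNReal.ofReal (8 * C) ^ d * ∑' a : Fin d → ℕ,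
          F t * ((∏ i, (halfRatio (α i) ^ 2) ^ a i) *
        ∑' k : Fin d → ℕ, (∏ i, ENNReal.ofReal (shiftWeight (α i) (k i))) *
          ENNReal.ofReal (dyK (fun i => M i - 1 - a i) (x + t + digitPtD k))) ∂μD d := by
        refine lintegral_mono fun t => ?_
        rw [ENNReal.tsum_mul_left, mul_left_comm]
        exact mul_le_mul_right (prod_ofReal_abs_KK_le hα hC hn hM (x + t)) _
    _ = ENNReal.ofReal (8 * C) ^ d * ∑' a : Fin d → ℕ, (∏ i, (halfRatio (α i) ^ 2) ^ a i) *
        dyAvg (fun i => M i - 1 - a i) (shiftAvg α F) x := by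
        rw [lintegral_const_mul _ (Measurable.tsum hterm),
          lintegral_tsum fun a => (hterm a).aemeasurable]
        congr 1
        refine tsum_congr fun a => ?_
        set N : Fin d → ℕ := fun i => M i - 1 - a i
        set w : ℝ≥0∞ := ∏ i, (halfRatio (α i) ^ 2) ^ a i
        have hk : ∀ k : Fin d → ℕ, Measurable fun t =>
            F t * ENNReal.ofReal (dyK N (x + t + digitPtD k)) := fun k => hF.mul (hD _ _)
        have hk' : ∀ k : Fin d → ℕ, Measurable fun t =>
            F (t + digitPtD k) * ENNReal.ofReal (dyK N (x + t)) := fun k =>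
          (hF.comp (measurable_add_const _)).mul (measurable_dyK_add_right N x)
        calc ∫⁻ t, F t * (w * ∑' k : Fin d → ℕ,
              (∏ i, ENNReal.ofReal (shiftWeight (α i) (k i))) *
                ENNReal.ofReal (dyK N (x + t + digitPtD k))) ∂μD d
            = ∫⁻ t, w * ∑' k : Fin d → ℕ, (∏ i, ENNReal.ofReal (shiftWeight (α i) (k i))) *
                (F t * ENNReal.ofReal (dyK N (x + t + digitPtD k))) ∂μD d := by
              refine lintegral_congr fun t => ?_
              rw [mul_left_comm, ← ENNReal.tsum_mul_left]
              simp only [mul_left_comm]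
          _ = w * ∑' k : Fin d → ℕ, (∏ i, ENNReal.ofReal (shiftWeight (α i) (k i))) *
                ∫⁻ t, F (t + digitPtD k) * ENNReal.ofReal (dyK N (x + t)) ∂μD d := by
              rw [lintegral_const_mul _ (Measurable.tsum fun k => (hk k).const_mul _),
                lintegral_tsum fun k => ((hk k).const_mul _).aemeasurable]
              congr 1
              refine tsum_congr fun k => ?_
              rw [lintegral_const_mul _ (hk k), lintegral_mul_shift_dyK]
          _ = w * dyAvg N (shiftAvg α F) x := by
              unfold dyAvg shiftAvg
              simp only [← ENNReal.tsum_mul_right, mul_assoc]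
              rw [lintegral_tsum fun k => ((hk' k).const_mul _).aemeasurable]
              congr 1
              refine tsum_congr fun k => ?_
              rw [lintegral_const_mul _ (hk' k)]

/-- The weak type `(1, 1)` inequality for the means along an increasing chain of levels. -/
lemma exists_weakType {α : Fin d → ℝ} (hα : ∀ i, 0 < α i ∧ α i ≤ 1) {C : ℝ} (hC : 1 ≤ C)
    {M : ℕ → Fin d → ℕ} (hmono : Monotone M) :
    ∃ K : ℝ≥0∞, K ≠ ∞ ∧ ∀ F : (Fin d → WG) → ℝ≥0∞, Measurable F → ∀ l : ℝ≥0∞,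
      l * μD d {x | ∃ m, ∃ n : Fin d → ℕ, (∀ i, n i < 2 ^ M m i) ∧
        (∀ i, (2 : ℝ) ^ M m i ≤ C * (n i + 1)) ∧
        K * l < ∫⁻ t, F t * ∏ i, ENNReal.ofReal |KK (α i) (n i) (x i + t i)| ∂μD d} ≤
      K * ∫⁻ t, F t ∂μD d := by
  set v : (Fin d → ℕ) → ℝ≥0∞ := fun a => ∏ i, halfRatio (α i) ^ a i with hv
  set V : ℝ≥0∞ := ∑' a, v a with hV
  set W : ℝ≥0∞ := ∑' k : Fin d → ℕ, ∏ i, ENNReal.ofReal (shiftWeight (α i) (k i)) with hW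
  have hVtop : V ≠ ∞ := by
    refine ne_top_of_le_ne_top ?_ (tsum_prod_le_prod_tsum fun i a => halfRatio (α i) ^ a)
    refine ENNReal.prod_ne_top fun i _ => ?_
    rw [ENNReal.tsum_geometric]
    exact ENNReal.inv_ne_top.2 (tsub_pos_of_lt (halfRatio_lt_one (hα i).1)).ne'
  have hWtop : W ≠ ∞ := by
    refine ne_top_of_le_ne_top ?_
      (tsum_prod_le_prod_tsum fun i k => ENNReal.ofReal (shiftWeight (α i) k))
    exact ENNReal.prod_ne_top fun i _ => (summable_shiftWeight (hα i).1).tsum_ofReal_ne_top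
  have hvpos : ∀ a, v a ≠ 0 := fun a =>
    Finset.prod_ne_zero_iff.2 fun i _ => pow_ne_zero _ (halfRatio_pos _).ne'
  have hvtop : ∀ a, v a ≠ ∞ := fun a => ne_top_of_le_ne_top hVtop (ENNReal.le_tsum a)
  have hvsq : ∀ a : Fin d → ℕ, ∏ i, (halfRatio (α i) ^ 2) ^ a i = v a * v a := by
    intro a
    rw [hv, ← Finset.prod_mul_distrib]
    exact Finset.prod_congr rfl fun i _ => by ring
  set c : ℝ≥0∞ := ENNReal.ofReal (8 * C) ^ d with hc
  have hctop : c ≠ ∞ := ENNReal.pow_ne_top ENNReal.ofReal_ne_top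
  refine ⟨c * V + V * W, by finiteness, fun F hF l => ?_⟩
  set g := shiftAvg α F with hg
  have hgm : Measurable g := measurable_shiftAvg α hF
  have hsub : {x | ∃ m, ∃ n : Fin d → ℕ, (∀ i, n i < 2 ^ M m i) ∧
        (∀ i, (2 : ℝ) ^ M m i ≤ C * (n i + 1)) ∧
        (c * V + V * W) * l < ∫⁻ t, F t * ∏ i, ENNReal.ofReal |KK (α i) (n i) (x i + t i)| ∂μD d} ⊆
      ⋃ a : Fin d → ℕ, ⋃ m, {x | l * (v a)⁻¹ < dyAvg (fun i => M m i - 1 - a i) g x} := by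
    rintro x ⟨m, n, h1, h2, h3⟩
    by_contra hx
    simp only [Set.mem_iUnion, Set.mem_ofPred_eq, not_exists, not_lt] at hx
    refine h3.not_ge ((lintegral_mul_prod_KK_le hα hC h1 h2 hF x).trans ?_)
    calc c * ∑' a : Fin d → ℕ, (∏ i, (halfRatio (α i) ^ 2) ^ a i) *
          dyAvg (fun i => M m i - 1 - a i) g x
        ≤ c * ∑' a : Fin d → ℕ, v a * l := by
          refine mul_le_mul_right (ENNReal.tsum_le_tsum fun a => ?_) _
          rw [hvsq]
          calc v a * v a * dyAvg (fun i => M m i - 1 - a i) g x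
              ≤ v a * v a * (l * (v a)⁻¹) := by gcongr; exact hx a m
            _ = v a * l * (v a * (v a)⁻¹) := by ring
            _ = v a * l := by rw [ENNReal.mul_inv_cancel (hvpos a) (hvtop a), mul_one]
      _ = c * V * l := by rw [ENNReal.tsum_mul_right, mul_assoc]
      _ ≤ (c * V + V * W) * l := by gcongr; exact le_self_add
  have hone : ∀ a : Fin d → ℕ, l * μD d (⋃ m, {x | l * (v a)⁻¹ <
      dyAvg (fun i => M m i - 1 - a i) g x}) ≤ v a * ∫⁻ x, g x ∂μD d := by
    intro a
    have hmono' : Monotone fun m => fun i => M m i - 1 - a i := fun m m' h i =>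
      Nat.sub_le_sub_right (Nat.sub_le_sub_right (hmono h i) 1) _
    have := mul_measure_iUnion_dyAvg_le hmono' hgm (l * (v a)⁻¹)
    calc _ = v a * (l * (v a)⁻¹ * μD d (⋃ m, {x | l * (v a)⁻¹ <
          dyAvg (fun i => M m i - 1 - a i) g x})) := by
          rw [← mul_assoc, mul_left_comm (v a), ENNReal.mul_inv_cancel (hvpos a) (hvtop a), mul_one]
      _ ≤ _ := by gcongr
  calc _ ≤ l * ∑' a : Fin d → ℕ, μD d (⋃ m, {x | l * (v a)⁻¹ <
        dyAvg (fun i => M m i - 1 - a i) g x}) := by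
        gcongr
        exact (measure_mono hsub).trans (measure_iUnion_le _)
    _ ≤ ∑' a : Fin d → ℕ, v a * ∫⁻ x, g x ∂μD d := by
        rw [← ENNReal.tsum_mul_left]
        exact ENNReal.tsum_le_tsum hone
    _ = V * W * ∫⁻ t, F t ∂μD d := by
        rw [ENNReal.tsum_mul_right, hg, lintegral_shiftAvg α hF, mul_assoc]
    _ ≤ (c * V + V * W) * ∫⁻ t, F t ∂μD d := by gcongr; exact le_add_self

end MaximalInequality

section Means

variable {d : ℕ}

lemma prod_KK_eq_cesaroOf (α : Fin d → ℝ) (n : Fin d → ℕ) (y : Fin d → WG) :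
    ∏ i, KK (α i) (n i) (y i) = cesaroOf d α (fun _ => 1) n y := by
  simp only [KK, cesaroOf, partialSumOf, Finset.prod_mul_distrib, Finset.prod_inv_distrib, dirK,
    kaczD, one_mul]
  rw [Finset.prod_univ_sum]
  congr 1
  refine Finset.sum_congr rfl fun k _ => ?_
  rw [Finset.prod_mul_distrib, Finset.prod_univ_sum]

lemma integrable_mul_kaczD {f : (Fin d → WG) → ℝ} (hf : Integrable f (μD d)) (m : Fin d → ℕ) :
    Integrable (fun t => f t * kaczD d m t) (μD d) :=
  hf.mul_bdd (c := 1) (continuous_kaczD m).measurable.aestronglyMeasurable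
    (Eventually.of_forall fun t => by rw [Real.norm_eq_abs, abs_kaczD])

lemma integrable_mul_kaczD_add {f : (Fin d → WG) → ℝ} (hf : Integrable f (μD d)) (m : Fin d → ℕ)
    (x : Fin d → WG) : Integrable (fun t => f t * kaczD d m (x + t)) (μD d) := by
  simp only [kaczD_add, mul_left_comm (f _)]
  exact (integrable_mul_kaczD hf m).const_mul _

lemma fCoeff_mul_kaczD (f : (Fin d → WG) → ℝ) (m : Fin d → ℕ) (x : Fin d → WG) :
    fCoeff d f m * kaczD d m x = ∫ t, f t * kaczD d m (x + t) ∂μD d := by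
  simp only [kaczD_add, mul_left_comm (f _), fCoeff]
  rw [integral_const_mul, mul_comm]

lemma sum_fCoeff_mul_kaczD {f : (Fin d → WG) → ℝ} (hf : Integrable f (μD d))
    (S : Finset (Fin d → ℕ)) (x : Fin d → WG) :
    ∑ m ∈ S, fCoeff d f m * kaczD d m x = ∫ t, f t * ∑ m ∈ S, kaczD d m (x + t) ∂μD d := by
  simp only [fCoeff_mul_kaczD, Finset.mul_sum]
  rw [integral_finsetSum _ fun m _ => integrable_mul_kaczD_add hf m x]

lemma cesaroOf_fCoeff {f : (Fin d → WG) → ℝ} (hf : Integrable f (μD d)) (α : Fin d → ℝ)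
    (n : Fin d → ℕ) (x : Fin d → WG) :
    cesaroOf d α (fCoeff d f) n x = ∫ t, f t * ∏ i, KK (α i) (n i) (x i + t i) ∂μD d := by
  have h : ∀ t, ∏ i, KK (α i) (n i) (x i + t i) = cesaroOf d α (fun _ => 1) n (x + t) := fun t =>
    prod_KK_eq_cesaroOf α n (x + t)
  simp only [h, cesaroOf, partialSumOf, one_mul, sum_fCoeff_mul_kaczD hf]
  have hfint : ∀ S : Finset (Fin d → ℕ),
      Integrable (fun t => f t * ∑ m ∈ S, kaczD d m (x + t)) (μD d) := fun S => by
    simp only [Finset.mul_sum]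
    exact integrable_finsetSum _ fun m _ => integrable_mul_kaczD_add hf m x
  simp only [Finset.mul_sum (Fintype.piFinset fun i => Finset.range (n i + 1)),
    mul_left_comm (f _)]
  rw [integral_finsetSum _ fun k _ => ((hfint _).const_mul _).const_mul _]
  simp only [integral_const_mul]

lemma enorm_cesaroOf_fCoeff_le {f : (Fin d → WG) → ℝ} (hf : Integrable f (μD d)) (α : Fin d → ℝ)
    (n : Fin d → ℕ) (x : Fin d → WG) :
    ‖cesaroOf d α (fCoeff d f) n x‖ₑ ≤
      ∫⁻ t, ‖f t‖ₑ * ∏ i, ENNReal.ofReal |KK (α i) (n i) (x i + t i)| ∂μD d := by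
  rw [cesaroOf_fCoeff hf]
  refine (enorm_integral_le_lintegral_enorm _).trans_eq (lintegral_congr fun t => ?_)
  rw [enorm_mul, Real.enorm_eq_ofReal_abs (∏ i, _), Finset.abs_prod,
    ENNReal.ofReal_prod_of_nonneg fun i _ => abs_nonneg _]

lemma cesaroOf_sub (α : Fin d → ℝ) (c c' : (Fin d → ℕ) → ℝ) (n : Fin d → ℕ) (x : Fin d → WG) :
    cesaroOf d α (fun m => c m - c' m) n x = cesaroOf d α c n x - cesaroOf d α c' n x := by
  simp only [cesaroOf, partialSumOf, sub_mul, Finset.sum_sub_distrib, mul_sub]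

lemma fCoeff_sub {f g : (Fin d → WG) → ℝ} (hf : Integrable f (μD d)) (hg : Integrable g (μD d))
    (m : Fin d → ℕ) : fCoeff d (fun x => f x - g x) m = fCoeff d f m - fCoeff d g m := by
  simp only [fCoeff, sub_mul]
  exact integral_sub (integrable_mul_kaczD hf m) (integrable_mul_kaczD hg m)

/-- The multiplier of the `(C, α)` mean of order `n` at the frequency `m`. -/
def cesaroFactor (α : ℝ) (m n : ℕ) : ℝ :=
  (Abin α n)⁻¹ * ∑ k ∈ Finset.range (n + 1), Abin (α - 1) (n - k) * (if m < k then 1 else 0)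

lemma cesaroOf_eq_sum_of_support {c : (Fin d → ℕ) → ℝ} {S : Finset (Fin d → ℕ)}
    (hc : ∀ m ∉ S, c m = 0) (α : Fin d → ℝ) (n : Fin d → ℕ) (x : Fin d → WG) :
    cesaroOf d α c n x =
      ∑ m ∈ S, c m * kaczD d m x * ∏ i, cesaroFactor (α i) (m i) (n i) := by
  have hps : ∀ k : Fin d → ℕ, partialSumOf d c k x =
      ∑ m ∈ S, c m * kaczD d m x * ∏ i, (if m i < k i then (1 : ℝ) else 0) := by
    intro k
    have hind : ∀ m : Fin d → ℕ, ∏ i, (if m i < k i then (1 : ℝ) else 0) =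
        if m ∈ Fintype.piFinset (fun i => Finset.range (k i)) then 1 else 0 := by
      intro m
      rw [Finset.prod_ite_zero]
      simp
    simp only [hind, mul_ite, mul_one, mul_zero]
    rw [← Finset.sum_filter, partialSumOf, ← Finset.sum_filter_of_ne
      (s := Fintype.piFinset fun i => Finset.range (k i)) (p := fun m => m ∈ S)
      fun m _ hm => by
        by_contra hmS
        exact hm (by rw [hc m hmS, zero_mul])]
    refine Finset.sum_congr ?_ fun _ _ => rfl
    ext m
    simp only [Finset.mem_filter]
    exact and_comm
  simp only [cesaroOf, hps, Finset.mul_sum]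
  rw [Finset.sum_comm]
  refine Finset.sum_congr rfl fun m _ => ?_
  simp only [cesaroFactor, Finset.prod_mul_distrib, Finset.prod_inv_distrib]
  rw [Finset.prod_univ_sum, Finset.mul_sum, Finset.mul_sum]
  refine Finset.sum_congr rfl fun k _ => ?_
  rw [Finset.prod_mul_distrib]
  ring

lemma abs_one_sub_cesaroFactor_le {α : ℝ} (h0 : 0 < α) (h1 : α ≤ 1) (m n : ℕ) :
    |1 - cesaroFactor α m n| ≤ ((m : ℝ) + 1) * ((n : ℝ) + 1) ^ (-α) := by
  have hA := rpow_le_Abin h0 h1 n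
  have hpos : (0 : ℝ) < ((n : ℝ) + 1) ^ α := by positivity
  have hApos : 0 < Abin α n := hpos.trans_le hA
  have hm1 : -1 ≤ α - 1 := by linarith
  have hsum : ∑ k ∈ Finset.range (n + 1), Abin (α - 1) (n - k) = Abin α n := by
    rw [← sum_Abin α n, ← Finset.sum_range_reflect (fun j => Abin (α - 1) j) (n + 1)]
    exact Finset.sum_congr rfl fun k _ => by simp
  have heq : 1 - cesaroFactor α m n = (Abin α n)⁻¹ *
      ∑ k ∈ Finset.range (n + 1), Abin (α - 1) (n - k) * (if k < m + 1 then 1 else 0) := by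
    rw [eq_comm, cesaroFactor, eq_sub_iff_add_eq, ← mul_add, ← Finset.sum_add_distrib]
    refine Eq.trans ?_ (inv_mul_cancel₀ hApos.ne')
    congr 1
    refine Eq.trans ?_ hsum
    refine Finset.sum_congr rfl fun k _ => ?_
    by_cases hk : m < k
    · rw [if_neg (by omega), if_pos hk]; ring
    · rw [if_pos (by omega), if_neg hk]; ring
  have hterm : ∀ k, 0 ≤ Abin (α - 1) (n - k) * (if k < m + 1 then (1 : ℝ) else 0) := fun k =>
    mul_nonneg (Abin_nonneg hm1 _) (by split_ifs <;> norm_num)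
  have hle : ∑ k ∈ Finset.range (n + 1), Abin (α - 1) (n - k) * (if k < m + 1 then (1 : ℝ) else 0) ≤
      (m : ℝ) + 1 := by
    calc _ ≤ ∑ k ∈ Finset.range (n + 1), (if k < m + 1 then (1 : ℝ) else 0) :=
          Finset.sum_le_sum fun k _ => mul_le_of_le_one_left (by split_ifs <;> norm_num)
            (Abin_le_one hm1 (by linarith) _)
      _ ≤ ((Finset.range (m + 1)).card : ℝ) := by
          rw [Finset.sum_boole]
          exact_mod_cast Finset.card_le_card fun k hk => by
            simpa using (Finset.mem_filter.1 hk).2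
      _ = (m : ℝ) + 1 := by simp
  rw [heq, abs_of_nonneg (mul_nonneg (by positivity) (Finset.sum_nonneg fun k _ => hterm k)),
    mul_comm, Real.rpow_neg (by positivity)]
  gcongr

lemma tendsto_cesaroFactor {α : ℝ} (h0 : 0 < α) (h1 : α ≤ 1) (m : ℕ) :
    Tendsto (cesaroFactor α m) atTop (nhds 1) := by
  rw [tendsto_iff_norm_sub_tendsto_zero]
  refine squeeze_zero (fun _ => norm_nonneg _) (fun n => ?_)
    (g := fun n : ℕ => ((m : ℝ) + 1) * ((n : ℝ) + 1) ^ (-α)) ?_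
  · rw [norm_sub_rev]
    exact abs_one_sub_cesaroFactor_le h0 h1 m n
  · have := ((tendsto_rpow_neg_atTop h0).comp
      (tendsto_atTop_add_const_right _ (1 : ℝ) tendsto_natCast_atTop_atTop)).const_mul ((m : ℝ) + 1)
    rwa [mul_zero] at this

lemma tendsto_cesaroOf_of_support {c : (Fin d → ℕ) → ℝ} {S : Finset (Fin d → ℕ)}
    (hc : ∀ m ∉ S, c m = 0) {α : Fin d → ℝ} (hα : ∀ i, 0 < α i ∧ α i ≤ 1) (x : Fin d → WG) :
    Tendsto (fun n => cesaroOf d α c n x) atTop (nhds (∑ m ∈ S, c m * kaczD d m x)) := by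
  simp only [cesaroOf_eq_sum_of_support hc]
  refine tendsto_finsetSum _ fun m _ => ?_
  rw [show nhds (c m * kaczD d m x) = nhds (c m * kaczD d m x * ∏ _i : Fin d, 1) by simp]
  refine Tendsto.const_mul _ (tendsto_finsetProd _ fun i _ => ?_)
  refine (tendsto_cesaroFactor (hα i).1 (hα i).2 (m i)).comp ?_
  exact tendsto_atTop.2 fun b => (eventually_ge_atTop (fun _ => b)).mono fun n hn => hn i

lemma fCoeff_sum_kaczD (S : Finset (Fin d → ℕ)) (c : (Fin d → ℕ) → ℝ) (m : Fin d → ℕ) :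
    fCoeff d (fun x => ∑ k ∈ S, c k * kaczD d k x) m = if m ∈ S then c m else 0 := by
  simp only [fCoeff, Finset.sum_mul, mul_assoc]
  rw [integral_finsetSum S (f := fun k x => c k * (kaczD d k x * kaczD d m x))
    fun k _ => (integrable_of_continuous_compact
    ((continuous_kaczD k).mul (continuous_kaczD m))).const_mul _]
  simp only [integral_const_mul, integral_kaczD_mul, mul_ite, mul_one, mul_zero]
  rw [Finset.sum_ite_eq' S m c]

end Means

section Density

variable {d : ℕ}

lemma integral_dyK_add (N : Fin d → ℕ) (x : Fin d → WG) : ∫ t, dyK N (x + t) ∂μD d = 1 := by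
  rw [integral_add_left_eq_self (μ := μD d) (fun t => dyK N t) x,
    integral_eq_lintegral_of_nonneg_ae (Eventually.of_forall (dyK_nonneg N))
      (continuous_dyK N).measurable.aestronglyMeasurable, lintegral_dyK, ENNReal.toReal_one]

lemma abs_integral_mul_dyK_sub_le {g : (Fin d → WG) → ℝ} (hg : Continuous g) {N : Fin d → ℕ}
    {x : Fin d → WG} {ε : ℝ} (h : ∀ t, (∀ i, ∀ j < N i, t i j = x i j) → |g t - g x| ≤ ε) :
    |∫ t, g t * dyK N (x + t) ∂μD d - g x| ≤ ε := by
  have hK : Continuous fun t => dyK N (x + t) := (continuous_dyK N).comp (continuous_const_add x)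
  have heq : ∫ t, g t * dyK N (x + t) ∂μD d - g x = ∫ t, (g t - g x) * dyK N (x + t) ∂μD d := by
    simp only [sub_mul]
    have h1 : Integrable (fun t => g t * dyK N (x + t)) (μD d) :=
      integrable_of_continuous_compact (hg.mul hK)
    have h2 : Integrable (fun t => g x * dyK N (x + t)) (μD d) :=
      integrable_of_continuous_compact (continuous_const.mul hK)
    rw [integral_sub h1 h2, integral_const_mul, integral_dyK_add, mul_one]
  rw [heq]
  refine (abs_integral_le_integral_abs).trans ?_
  calc ∫ t, |(g t - g x) * dyK N (x + t)| ∂μD d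
      ≤ ∫ t, ε * dyK N (x + t) ∂μD d := by
        refine integral_mono (integrable_of_continuous_compact
          (((hg.sub continuous_const).mul hK).abs))
          (integrable_of_continuous_compact (continuous_const.mul hK)) fun t => ?_
        by_cases h0 : dyK N (x + t) = 0
        · simp [h0]
        · rw [abs_mul, abs_of_nonneg (dyK_nonneg N _)]
          refine mul_le_mul_of_nonneg_right (h t fun i j hj => ?_) (dyK_nonneg N _)
          have := zeros_of_dyK_ne_zero h0 i j hj
          exact (CharTwo.add_eq_zero.1 this).symm
    _ = ε := by rw [integral_const_mul, integral_dyK_add, mul_one]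

lemma tendsto_integral_mul_dyK {g : (Fin d → WG) → ℝ} (hg : Continuous g) (x : Fin d → WG) :
    Tendsto (fun M : ℕ => ∫ t, g t * dyK (fun _ => M) (x + t) ∂μD d) atTop (nhds (g x)) := by
  rw [Metric.tendsto_atTop]
  intro ε hε
  obtain ⟨M, hM⟩ : ∃ M : ℕ, ∀ t : Fin d → WG, (∀ i, ∀ j < M, t i j = x i j) →
      |g t - g x| ≤ ε / 2 := by
    by_contra! H
    choose t ht hgt using H
    have htx : Tendsto t atTop (nhds x) := by
      refine tendsto_pi_nhds.2 fun i => tendsto_pi_nhds.2 fun j => ?_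
      exact tendsto_const_nhds.congr' ((eventually_gt_atTop j).mono fun M hM => (ht M i j hM).symm)
    have hlim := ((hg.tendsto x).comp htx).sub_const (g x)
    rw [sub_self] at hlim
    have := hlim.abs
    rw [abs_zero] at this
    obtain ⟨M, hM⟩ := (this.eventually_lt_const (half_pos hε)).exists
    exact lt_asymm hM (hgt M)
  refine ⟨M, fun M' hM' => ?_⟩
  rw [Real.dist_eq]
  refine (abs_integral_mul_dyK_sub_le hg fun t ht => hM t fun i j hj =>
    ht i j (hj.trans_le hM')).trans_lt (half_lt_self hε)

/-- The Walsh–Kaczmarz polynomials are dense in `L¹`. -/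
lemma exists_polynomial_lintegral_enorm_sub_le {f : (Fin d → WG) → ℝ} (hf : Integrable f (μD d))
    {δ : ℝ} (hδ : 0 < δ) : ∃ (S : Finset (Fin d → ℕ)) (c : (Fin d → ℕ) → ℝ),
      ∫⁻ x, ‖f x - ∑ m ∈ S, c m * kaczD d m x‖ₑ ∂μD d ≤ ENNReal.ofReal δ := by
  obtain ⟨g, -, hfg, hgc, hgi⟩ :=
    hf.exists_hasCompactSupport_integral_sub_le (half_pos hδ)
  obtain ⟨B, hB⟩ : ∃ B : ℝ, ∀ x, |g x| ≤ B := by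
    obtain ⟨B, hB⟩ := isCompact_univ.exists_bound_of_continuousOn hgc.continuousOn
    exact ⟨B, fun x => hB x (Set.mem_univ x)⟩
  set p : ℕ → (Fin d → WG) → ℝ := fun M x =>
    ∑ m ∈ Fintype.piFinset (fun _ : Fin d => Finset.range (2 ^ M)), fCoeff d g m * kaczD d m x
    with hp
  have hpc : ∀ M, Continuous (p M) := fun M =>
    continuous_finsetSum _ fun m _ => continuous_const.mul (continuous_kaczD m)
  have hpeq : ∀ M x, p M x = ∫ t, g t * dyK (fun _ => M) (x + t) ∂μD d := by
    intro M x
    simp only [hp, sum_fCoeff_mul_kaczD hgi, dyK_eq_sum]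
  have hlim : Tendsto (fun M => ∫ x, |g x - p M x| ∂μD d) atTop (nhds (∫ _x, (0 : ℝ) ∂μD d)) := by
    refine tendsto_integral_of_dominated_convergence (fun _ => 2 * B)
      (fun M => (hgc.sub (hpc M)).abs.measurable.aestronglyMeasurable) (integrable_const _)
      (fun M => Eventually.of_forall fun x => ?_) (Eventually.of_forall fun x => ?_)
    · rw [Real.norm_eq_abs, abs_abs, hpeq, abs_sub_comm]
      refine abs_integral_mul_dyK_sub_le hgc fun t _ => ?_
      have := abs_sub (g t) (g x)
      linarith [hB t, hB x]
    · have h := (tendsto_integral_mul_dyK hgc x).const_sub (g x)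
      simp only [← hpeq, sub_self] at h
      simpa using h.abs
  rw [integral_zero] at hlim
  obtain ⟨M, hM⟩ := (hlim.eventually_lt_const (half_pos hδ)).exists
  refine ⟨Fintype.piFinset fun _ : Fin d => Finset.range (2 ^ M), fCoeff d g, ?_⟩
  change ∫⁻ x, ‖f x - p M x‖ₑ ∂μD d ≤ _
  have hpi : Integrable (p M) (μD d) := integrable_of_continuous_compact (hpc M)
  have hfp : Integrable (fun x => f x - p M x) (μD d) := hf.sub hpi
  rw [← ofReal_integral_norm_eq_lintegral_enorm hfp]
  refine ENNReal.ofReal_le_ofReal ?_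
  calc ∫ x, ‖f x - p M x‖ ∂μD d ≤ ∫ x, (‖f x - g x‖ + |g x - p M x|) ∂μD d := by
        refine integral_mono hfp.norm ((hf.sub hgi).norm.add (hgi.sub hpi).abs) fun x => ?_
        exact norm_sub_le_norm_sub_add_norm_sub _ _ _
    _ = ∫ x, ‖f x - g x‖ ∂μD d + ∫ x, |g x - p M x| ∂μD d :=
        integral_add (hf.sub hgi).norm (hgi.sub hpi).abs
    _ ≤ δ / 2 + δ / 2 := add_le_add hfg hM.le
    _ = δ := add_halves δ

end Density

section ConeLike

variable {d : ℕ}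

lemma IsCRF.exists_doubling {γ : Fin (d + 1) → ℝ → ℝ} (hγ : IsCRF (d + 1) γ)
    {j : Fin (d + 1)} (hj : j ≠ 0) :
    ∃ D : ℝ, 1 ≤ D ∧ ∀ x : ℝ, 1 ≤ x → γ j (2 * x) ≤ D * γ j x := by
  obtain ⟨ζ, hζ, h⟩ := hγ.reg
  obtain ⟨c₁, c₂, -, hc₂, hc⟩ := h j hj
  have hiter : ∀ (k : ℕ) (x : ℝ), 1 ≤ x → γ j (ζ ^ k * x) ≤ c₂ ^ k * γ j x := by
    intro k
    induction k with
    | zero => intro x _; simp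
    | succ k ih =>
      intro x hx
      have hx' : 1 ≤ ζ ^ k * x := one_le_mul_of_one_le_of_one_le (one_le_pow₀ hζ.le) hx
      calc γ j (ζ ^ (k + 1) * x) = γ j (ζ * (ζ ^ k * x)) := by rw [pow_succ']; ring_nf
        _ ≤ c₂ * γ j (ζ ^ k * x) := (hc _ hx').2
        _ ≤ c₂ * (c₂ ^ k * γ j x) := by gcongr; exact ih x hx
        _ = c₂ ^ (k + 1) * γ j x := by ring
  obtain ⟨k, hk⟩ := pow_unbounded_of_one_lt 2 hζ
  refine ⟨c₂ ^ k, one_le_pow₀ hc₂.le, fun x hx => le_trans ?_ (hiter k x hx)⟩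
  have h2 : 2 * x ≤ ζ ^ k * x := by gcongr
  exact (hγ.strictMono j hj).monotoneOn (by simp; linarith) (by simp; linarith) h2

lemma lt_two_pow_log_floor_add_one {n : ℕ} {Y : ℝ} (hY : 1 ≤ Y) (hn : (n : ℝ) ≤ Y) :
    n < 2 ^ (Nat.log 2 ⌊Y⌋₊ + 1) ∧ (2 : ℝ) ^ (Nat.log 2 ⌊Y⌋₊ + 1) ≤ 2 * Y := by
  have hfl : ⌊Y⌋₊ ≠ 0 := (Nat.floor_pos.2 hY).ne'
  refine ⟨(Nat.le_floor hn).trans_lt (Nat.lt_pow_succ_log_self (by norm_num) _), ?_⟩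
  have h1 : ((2 ^ Nat.log 2 ⌊Y⌋₊ : ℕ) : ℝ) ≤ (⌊Y⌋₊ : ℝ) := by
    exact_mod_cast Nat.pow_log_le_self 2 hfl
  have h2 := Nat.floor_le (zero_le_one.trans hY)
  push_cast at h1
  rw [pow_succ]
  linarith

/-- The indices of a cone-like set are covered by a monotone chain of dyadic levels. -/
lemma IsCRF.exists_chain {γ : Fin (d + 1) → ℝ → ℝ} (hγ : IsCRF (d + 1) γ)
    {β : Fin (d + 1) → ℝ} (hβ : ∀ j : Fin (d + 1), j ≠ 0 → 1 ≤ β j) :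
    ∃ C : ℝ, 1 ≤ C ∧ ∃ M : ℕ → Fin (d + 1) → ℕ, Monotone M ∧
      ∀ n ∈ coneLike (d + 1) γ β, (∀ j, 1 ≤ n j) →
        ∃ m, (∀ i, n i < 2 ^ M m i) ∧ ∀ i, (2 : ℝ) ^ M m i ≤ C * (n i + 1) := by
  have hD : ∀ j : Fin (d + 1), ∃ D : ℝ, 1 ≤ D ∧
      (j ≠ 0 → ∀ x : ℝ, 1 ≤ x → γ j (2 * x) ≤ D * γ j x) := by
    intro j
    by_cases hj : j = 0
    · exact ⟨1, le_rfl, fun h => (h hj).elim⟩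
    · obtain ⟨D, h1, h2⟩ := hγ.exists_doubling hj
      exact ⟨D, h1, fun _ => h2⟩
  choose D hD1 hD2 using hD
  set M : ℕ → Fin (d + 1) → ℕ := fun m j =>
    if j = 0 then m + 1 else Nat.log 2 ⌊β j * γ j (2 ^ (m + 1))⌋₊ + 1 with hM
  have hpow : ∀ m : ℕ, (1 : ℝ) ≤ 2 ^ m := fun m => one_le_pow₀ (by norm_num)
  have hnn : ∀ j, 0 ≤ D j * (β j) ^ 2 := fun j =>
    mul_nonneg (zero_le_one.trans (hD1 j)) (sq_nonneg _)
  refine ⟨2 + ∑ j, 2 * (D j * (β j) ^ 2), ?_, M, ?_, ?_⟩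
  · have : 0 ≤ ∑ j, 2 * (D j * (β j) ^ 2) := Finset.sum_nonneg fun j _ => by linarith [hnn j]
    linarith
  · intro m m' hmm j
    by_cases hj : j = 0
    · simpa [hM, hj] using hmm
    · simp only [hM, hj, if_false]
      have hmono : γ j (2 ^ (m + 1)) ≤ γ j (2 ^ (m' + 1)) :=
        (hγ.strictMono j hj).monotoneOn (hpow _) (hpow _)
          (pow_le_pow_right₀ (by norm_num) (by omega))
      have := hβ j hj
      gcongr
  · intro n hn hn1
    have h0 : (1 : ℝ) ≤ n 0 := by exact_mod_cast hn1 0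
    have hlog1 : (2 : ℝ) ^ Nat.log 2 (n 0) ≤ n 0 := by
      exact_mod_cast Nat.pow_log_le_self 2 (by have := hn1 0; omega)
    have hlog2 : n 0 < 2 ^ (Nat.log 2 (n 0) + 1) := Nat.lt_pow_succ_log_self (by norm_num) _
    have hlog2' : (n 0 : ℝ) ≤ 2 ^ (Nat.log 2 (n 0) + 1) := by exact_mod_cast hlog2.le
    have hCj : ∀ j, 2 * (D j * (β j) ^ 2) ≤ 2 + ∑ j, 2 * (D j * (β j) ^ 2) := fun j => by
      have := Finset.single_le_sum (f := fun j => 2 * (D j * (β j) ^ 2))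
        (fun j _ => by linarith [hnn j]) (Finset.mem_univ j)
      linarith
    have hC2 : 2 ≤ 2 + ∑ j, 2 * (D j * (β j) ^ 2) :=
      le_add_of_nonneg_right (Finset.sum_nonneg fun j _ => by linarith [hnn j])
    have key : ∀ j, j ≠ 0 → 1 ≤ β j * γ j (2 ^ (Nat.log 2 (n 0) + 1)) ∧
        (n j : ℝ) ≤ β j * γ j (2 ^ (Nat.log 2 (n 0) + 1)) ∧
        β j * γ j (2 ^ (Nat.log 2 (n 0) + 1)) ≤ D j * (β j) ^ 2 * n j := by
      intro j hj
      have hb := hβ j hj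
      have hb0 : 0 < β j := zero_lt_one.trans_le hb
      obtain ⟨hl, hr⟩ := hn j hj
      have hm := (hγ.strictMono j hj).monotoneOn
      refine ⟨one_le_mul_of_one_le_of_one_le hb (hγ.one_le j hj _ (hpow _)), hr.trans ?_, ?_⟩
      · gcongr
        exact hm h0 (hpow _) hlog2'
      · have h1 : γ j (2 ^ (Nat.log 2 (n 0) + 1)) ≤ γ j (2 * n 0) := by
          refine hm (hpow _) (Set.mem_Ici.2 (by linarith)) ?_
          rw [pow_succ']
          linarith
        have h2 := hD2 j hj _ h0
        have h3 : γ j (n 0) ≤ β j * n j := by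
          rwa [inv_mul_le_iff₀ hb0] at hl
        calc β j * γ j (2 ^ (Nat.log 2 (n 0) + 1)) ≤ β j * (D j * (β j * n j)) := by
              have := hD1 j
              gcongr
              exact h1.trans (h2.trans (by gcongr))
          _ = D j * (β j) ^ 2 * n j := by ring
    refine ⟨Nat.log 2 (n 0), fun j => ?_, fun j => ?_⟩
    · by_cases hj : j = 0
      · simpa [hM, hj] using hlog2
      · simp only [hM, hj, if_false]
        exact (lt_two_pow_log_floor_add_one (key j hj).1 (key j hj).2.1).1
    · have hnj : (0 : ℝ) ≤ n j := by positivity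
      by_cases hj : j = 0
      · subst hj
        simp only [hM, if_true]
        have hps : (2 : ℝ) ^ (Nat.log 2 (n 0) + 1) = 2 ^ Nat.log 2 (n 0) * 2 := pow_succ _ _
        rw [hps]
        nlinarith
      · simp only [hM, hj, if_false]
        refine (lt_two_pow_log_floor_add_one (key j hj).1 (key j hj).2.1).2.trans ?_
        nlinarith [(key j hj).2.2, hCj j, hnn j]

lemma IsCRF.exists_weakType_cesaro {γ : Fin (d + 1) → ℝ → ℝ} (hγ : IsCRF (d + 1) γ)
    {β : Fin (d + 1) → ℝ} (hβ : ∀ j : Fin (d + 1), j ≠ 0 → 1 ≤ β j)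
    {α : Fin (d + 1) → ℝ} (hα : ∀ i, 0 < α i ∧ α i ≤ 1) :
    ∃ K : ℝ≥0∞, K ≠ ∞ ∧ ∀ f : (Fin (d + 1) → WG) → ℝ, Integrable f (μD (d + 1)) → ∀ l : ℝ≥0∞,
      l * μD (d + 1) {x | ∃ n ∈ coneLike (d + 1) γ β, (∀ j, 1 ≤ n j) ∧
        K * l < ‖cesaroOf (d + 1) α (fCoeff (d + 1) f) n x‖ₑ} ≤ K * ∫⁻ t, ‖f t‖ₑ ∂μD (d + 1) := by
  obtain ⟨C, hC, M, hM, hcov⟩ := hγ.exists_chain hβ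
  obtain ⟨K, hK, H⟩ := exists_weakType hα hC hM
  refine ⟨K, hK, fun f hf l => ?_⟩
  have hfm : AEMeasurable (fun t => ‖f t‖ₑ) (μD (d + 1)) := hf.aestronglyMeasurable.enorm
  rw [lintegral_congr_ae hfm.ae_eq_mk]
  refine le_trans ?_ (H _ hfm.measurable_mk l)
  refine mul_le_mul_right (measure_mono ?_) _
  rintro x ⟨n, hn, hn1, hlt⟩
  obtain ⟨m, h1, h2⟩ := hcov n hn hn1
  refine ⟨m, n, h1, h2, hlt.trans_le ((enorm_cesaroOf_fCoeff_le hf α n x).trans_eq ?_)⟩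
  refine lintegral_congr_ae ?_
  filter_upwards [hfm.ae_eq_mk] with t ht
  rw [ht]

lemma IsCRF.ae_eventually_abs_cesaroOf_sub_le {γ : Fin (d + 1) → ℝ → ℝ} (hγ : IsCRF (d + 1) γ)
    {β : Fin (d + 1) → ℝ} (hβ : ∀ j : Fin (d + 1), j ≠ 0 → 1 ≤ β j)
    {α : Fin (d + 1) → ℝ} (hα : ∀ i, 0 < α i ∧ α i ≤ 1) :
    ∃ B : ℝ, 0 ≤ B ∧ ∀ f : (Fin (d + 1) → WG) → ℝ, Integrable f (μD (d + 1)) → ∀ ε : ℝ, 0 < ε →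
      ∀ᵐ x ∂μD (d + 1), ∀ᶠ n in atTop ⊓ 𝓟 (coneLike (d + 1) γ β),
        |cesaroOf (d + 1) α (fCoeff (d + 1) f) n x - f x| ≤ B * ε := by
  obtain ⟨K, hK, H⟩ := hγ.exists_weakType_cesaro hβ hα
  refine ⟨K.toReal + 2, by positivity, fun f hf ε hε => ?_⟩
  rw [ae_iff]
  set E := {x | ¬∀ᶠ n in atTop ⊓ 𝓟 (coneLike (d + 1) γ β),
    |cesaroOf (d + 1) α (fCoeff (d + 1) f) n x - f x| ≤ (K.toReal + 2) * ε} with hE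
  have hεE : ENNReal.ofReal ε ≠ 0 := (ENNReal.ofReal_pos.2 hε).ne'
  have hbound : ∀ δ : ℝ, 0 < δ →
      ENNReal.ofReal ε * μD (d + 1) E ≤ (K + 1) * ENNReal.ofReal δ := by
    intro δ hδ
    obtain ⟨S, c, hSc⟩ := exists_polynomial_lintegral_enorm_sub_le hf hδ
    set p : (Fin (d + 1) → WG) → ℝ := fun x => ∑ m ∈ S, c m * kaczD (d + 1) m x with hp
    have hpi : Integrable p (μD (d + 1)) := integrable_of_continuous_compact
      (continuous_finsetSum _ fun m _ => continuous_const.mul (continuous_kaczD m))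
    have hh : Integrable (fun x => f x - p x) (μD (d + 1)) := hf.sub hpi
    have hpt : ∀ x, Tendsto (fun n => cesaroOf (d + 1) α (fCoeff (d + 1) p) n x) atTop
        (nhds (p x)) := by
      intro x
      have hpc : fCoeff (d + 1) p = fun m => if m ∈ S then c m else 0 :=
        funext fun m => fCoeff_sum_kaczD S c m
      rw [hpc]
      convert tendsto_cesaroOf_of_support (S := S) (fun m hm => if_neg hm) hα x using 2
      exact Finset.sum_congr rfl fun m hm => by rw [if_pos hm]
    set A₁ := {x | ∃ n ∈ coneLike (d + 1) γ β, (∀ j, 1 ≤ n j) ∧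
      K * ENNReal.ofReal ε <
        ‖cesaroOf (d + 1) α (fCoeff (d + 1) fun x => f x - p x) n x‖ₑ} with hA₁
    set A₂ := {x | ENNReal.ofReal ε ≤ ‖f x - p x‖ₑ} with hA₂
    have hsub : E ⊆ A₁ ∪ A₂ := by
      intro x hx
      by_contra hx'
      simp only [hA₁, hA₂, Set.mem_union, Set.mem_ofPred_eq, not_or, not_exists, not_and, not_lt,
        not_le] at hx'
      obtain ⟨h1, h2⟩ := hx'
      refine hx ?_
      have hev : ∀ᶠ n in atTop ⊓ 𝓟 (coneLike (d + 1) γ β), n ∈ coneLike (d + 1) γ β :=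
        mem_inf_of_right (mem_principal_self _)
      have hge : ∀ᶠ n : Fin (d + 1) → ℕ in atTop ⊓ 𝓟 (coneLike (d + 1) γ β), (fun _ => 1) ≤ n :=
        (eventually_ge_atTop _).filter_mono inf_le_left
      have hpx : ∀ᶠ n in atTop ⊓ 𝓟 (coneLike (d + 1) γ β),
          |cesaroOf (d + 1) α (fCoeff (d + 1) p) n x - p x| < ε :=
        ((Metric.tendsto_nhds.1 (hpt x)) ε hε).filter_mono inf_le_left
      filter_upwards [hev, hge, hpx] with n hn hn1 hnp
      have h1' := h1 n hn hn1
      rw [← ENNReal.ofReal_toReal hK, ← ENNReal.ofReal_mul ENNReal.toReal_nonneg,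
        Real.enorm_eq_ofReal_abs, ENNReal.ofReal_le_ofReal_iff (by positivity)] at h1'
      rw [Real.enorm_eq_ofReal_abs, ENNReal.ofReal_lt_ofReal_iff hε] at h2
      have hsplit : cesaroOf (d + 1) α (fCoeff (d + 1) fun x => f x - p x) n x =
          cesaroOf (d + 1) α (fCoeff (d + 1) f) n x -
            cesaroOf (d + 1) α (fCoeff (d + 1) p) n x := by
        rw [← cesaroOf_sub, funext (fCoeff_sub hf hpi)]
      rw [hsplit] at h1'
      rw [abs_le] at h1' ⊢
      rw [abs_lt] at h2 hnp
      constructor <;> linarith [h1'.1, h1'.2, h2.1, h2.2, hnp.1, hnp.2]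
    calc ENNReal.ofReal ε * μD (d + 1) E
        ≤ ENNReal.ofReal ε * (μD (d + 1) A₁ + μD (d + 1) A₂) := by
          gcongr
          exact (measure_mono hsub).trans (measure_union_le _ _)
      _ = ENNReal.ofReal ε * μD (d + 1) A₁ + ENNReal.ofReal ε * μD (d + 1) A₂ := mul_add _ _ _
      _ ≤ K * ∫⁻ t, ‖f t - p t‖ₑ ∂μD (d + 1) + ∫⁻ t, ‖f t - p t‖ₑ ∂μD (d + 1) :=
          add_le_add (H _ hh _)
            (mul_meas_ge_le_lintegral₀ hh.aestronglyMeasurable.enorm _)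
      _ = (K + 1) * ∫⁻ t, ‖f t - p t‖ₑ ∂μD (d + 1) := by rw [add_mul, one_mul]
      _ ≤ (K + 1) * ENNReal.ofReal δ := by gcongr
  have hlim : Tendsto (fun δ : ℝ => (K + 1) * ENNReal.ofReal δ) (nhdsWithin 0 (Set.Ioi 0))
      (nhds 0) := by
    have h0 : Tendsto ENNReal.ofReal (nhdsWithin 0 (Set.Ioi 0)) (nhds 0) := by
      have := (ENNReal.continuous_ofReal.tendsto 0).mono_left
        (nhdsWithin_le_nhds (s := Set.Ioi (0 : ℝ)))
      rwa [ENNReal.ofReal_zero] at this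
    have := ENNReal.Tendsto.const_mul (a := K + 1) h0 (Or.inr (by finiteness))
    rwa [mul_zero] at this
  have hzero : ENNReal.ofReal ε * μD (d + 1) E ≤ 0 :=
    ge_of_tendsto hlim (eventually_mem_nhdsWithin.mono fun δ hδ => hbound δ hδ)
  exact (mul_eq_zero.1 (nonpos_iff_eq_zero.1 hzero)).resolve_left hεE

end ConeLike

/-- Theorem 2: for every integrable `f`, the `(C,α)` means
`σ_n^{κ,α} f` converge to `f` a.e. as `min n_i → ∞` with `n` inside the cone-like set `L`. -/
theorem cesaro_coneLike_ae_convergence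
    (d : ℕ) (α : Fin (d + 1) → ℝ) (hα : ∀ i, 0 < α i ∧ α i ≤ 1)
    (γ : Fin (d + 1) → ℝ → ℝ) (hγ : IsCRF (d + 1) γ)
    (β : Fin (d + 1) → ℝ) (hβ : ∀ j : Fin (d + 1), j ≠ 0 → 1 ≤ β j)
    (f : (Fin (d + 1) → WG) → ℝ) (hf : Integrable f (μD (d + 1))) :
    ∀ᵐ x ∂ μD (d + 1),
      Tendsto (fun n => cesaroOf (d + 1) α (fCoeff (d + 1) f) n x)
        (atTop ⊓ 𝓟 (coneLike (d + 1) γ β)) (nhds (f x)) := by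
  obtain ⟨B, hB, H⟩ := hγ.ae_eventually_abs_cesaroOf_sub_le hβ hα
  have hall : ∀ᵐ x ∂μD (d + 1), ∀ k : ℕ, ∀ᶠ n in atTop ⊓ 𝓟 (coneLike (d + 1) γ β),
      |cesaroOf (d + 1) α (fCoeff (d + 1) f) n x - f x| ≤ B * (1 / ((k : ℝ) + 1)) :=
    ae_all_iff.2 fun k => H f hf _ Nat.one_div_pos_of_nat
  filter_upwards [hall] with x hx
  rw [Metric.tendsto_nhds]
  intro ε hε
  have hlim : Tendsto (fun k : ℕ => B * (1 / ((k : ℝ) + 1))) atTop (nhds 0) := by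
    simpa using tendsto_one_div_add_atTop_nhds_zero_nat.const_mul B
  obtain ⟨k, hk⟩ := (hlim.eventually_lt_const hε).exists
  exact (hx k).mono fun n hn => hn.trans_lt hk

end
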